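/- Let 1<p<∞, let i₀>0, and let ζ₀ ∈ L^p(Π) be nonnegative with compact support. Then every ζ ∈ W(ζ₀,≤i₀) is the weak limit in L^p(Π) of a sequence (ζₙ) of elements of R⁺(ζ₀) satisfying I(ζₙ) ≤ i₀ for every n. -/

import Mathlib

open MeasureTheory Real Filter Topology

noncomputable section

/-- The open upper half-plane Π. -/
def UHP : Set (ℝ × ℝ) := {x | 0 < x.2}

/-- Planar Lebesgue measure restricted to the upper half-plane. -/
def μUH : Measure (ℝ × ℝ) := MeasureTheory.volume.restrict UHP

/-- Squared Euclidean distance in the plane. -/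
def sqdist (x y : ℝ × ℝ) : ℝ := (x.1 - y.1) ^ 2 + (x.2 - y.2) ^ 2

/-- Euclidean distance in the plane. -/
def euclDist (x y : ℝ × ℝ) : ℝ := Real.sqrt (sqdist x y)

/-- The Green's function of −Δ in the upper half-plane:
`G(x,y) = (1/(4π)) log(1 + 4 x₂ y₂ / |x−y|²)`. -/
def greenG (x y : ℝ × ℝ) : ℝ :=
  (4 * π)⁻¹ * Real.log (1 + 4 * x.2 * y.2 / sqdist x y)

/-- The stream-function operator `𝒢ζ(x) = ∫_Π G(x,y) ζ(y) dy`. -/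
def Gop (ζ : ℝ × ℝ → ℝ) (x : ℝ × ℝ) : ℝ := ∫ y, greenG x y * ζ y ∂μUH

/-- Kinetic energy `E(ζ) = (1/2) ∫_Π ζ 𝒢ζ`. -/
def energy (ζ : ℝ × ℝ → ℝ) : ℝ := (1 / 2) * ∫ x, ζ x * Gop ζ x ∂μUH

/-- Impulse `I(ζ) = ∫_Π ζ(y) y₂ dy`. -/
def impulse (ζ : ℝ × ℝ → ℝ) : ℝ := ∫ y, ζ y * y.2 ∂μUH

/-- The `L^p(Π)` norm, as a real number. -/
def lpN (p : ℝ) (ζ : ℝ × ℝ → ℝ) : ℝ := (eLpNorm ζ (ENNReal.ofReal p) μUH).toReal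

/-- `f ⪯ g` : `∫ (f−a)₊ ≤ ∫ (g−a)₊` for every `a > 0`. -/
def prec (f g : ℝ × ℝ → ℝ) : Prop :=
  ∀ a : ℝ, 0 < a → ∫ x, max (f x - a) 0 ∂μUH ≤ ∫ x, max (g x - a) 0 ∂μUH

/-- `f` is a rearrangement of `g` on Π. -/
def IsRearr (f g : ℝ × ℝ → ℝ) : Prop :=
  ∀ a : ℝ, 0 < a → μUH {x | a < f x} = μUH {x | a < g x}

/-- Membership of the relaxed constraint class `𝒲(ζ₀)`. -/
def memW (ζ₀ ζ : ℝ × ℝ → ℝ) : Prop :=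
  (∀ x, 0 ≤ ζ x) ∧ Integrable ζ μUH ∧ prec ζ ζ₀

/-- `𝒲(ζ₀, ≤ i₀)`. -/
def Wle (ζ₀ : ℝ × ℝ → ℝ) (i₀ : ℝ) : Set (ℝ × ℝ → ℝ) :=
  {ζ | memW ζ₀ ζ ∧ impulse ζ ≤ i₀}

/-- `𝒲(ζ₀, i₀)`. -/
def Weq (ζ₀ : ℝ × ℝ → ℝ) (i₀ : ℝ) : Set (ℝ × ℝ → ℝ) :=
  {ζ | memW ζ₀ ζ ∧ impulse ζ = i₀}

/-- Membership of `ℛ⁺(ζ₀)`: restrictions of rearrangements of `ζ₀`. -/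
def memRplus (ζ₀ ζ : ℝ × ℝ → ℝ) : Prop :=
  ∃ ξ : ℝ × ℝ → ℝ, ∃ A : Set (ℝ × ℝ), IsRearr ξ ζ₀ ∧ MeasurableSet A ∧
    ζ = A.indicator ξ

/-- Steiner symmetry about the `x₂`-axis. -/
def SteinerSym (ζ : ℝ × ℝ → ℝ) : Prop :=
  ∀ᵐ t ∂(MeasureTheory.volume.restrict (Set.Ioi (0 : ℝ))),
    (∀ s : ℝ, ζ (-s, t) = ζ (s, t)) ∧
    (∀ s₁ s₂ : ℝ, 0 ≤ s₁ → s₁ ≤ s₂ → ζ (s₂, t) ≤ ζ (s₁, t))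

/-- The decreasing rearrangement `ζ^Δ(s) = inf {a > 0 : |{ζ > a}| ≤ s}`. -/
def decRearr (ζ : ℝ × ℝ → ℝ) (s : ℝ) : ℝ :=
  sInf {a : ℝ | 0 < a ∧ μUH {x | a < ζ x} ≤ ENNReal.ofReal s}

/-- The norm `‖ζ‖_{𝔛^p} = |I(ζ)| + ‖ζ‖₁ + ‖ζ‖_p`. -/
def XpNorm (p : ℝ) (ζ : ℝ × ℝ → ℝ) : ℝ := |impulse ζ| + lpN 1 ζ + lpN p ζ

/-- Distance to a set of functions in the `𝔛^p` norm. -/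
def XpDist (p : ℝ) (ζ : ℝ × ℝ → ℝ) (S : Set (ℝ × ℝ → ℝ)) : ℝ :=
  sInf ((fun σ => XpNorm p fun x => ζ x - σ x) '' S)


open scoped NNReal ENNReal

/-- Quantile function of a finite measure. -/
lemma exists_quantile (ν : Measure ℝ) [IsFiniteMeasure ν] :
    ∃ e : ℝ → ℝ≥0, Measurable e ∧ ∀ (a : ℝ≥0) (t : ℝ),
      a < e t ↔ (0 < t ∧ ENNReal.ofReal t < ν (Set.Ioi (a : ℝ))) := by
  classical
  have key : ∀ (a : ℝ≥0) (t : ℝ), a < (if 0 < t then sInf {b : ℝ≥0 | ν (Set.Ioi (b : ℝ)) ≤ ENNReal.ofReal t} else 0)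
      ↔ (0 < t ∧ ENNReal.ofReal t < ν (Set.Ioi (a : ℝ))) := by
    intro a t
    by_cases ht : 0 < t
    · simp only [ht, if_true, true_and]
      set S := {b : ℝ≥0 | ν (Set.Ioi (b : ℝ)) ≤ ENNReal.ofReal t} with hS
      have hne : S.Nonempty := by
        have h1 : Tendsto (fun n : ℕ => ν (Set.Ioi (n : ℝ))) atTop (𝓝 (ν (⋂ n : ℕ, Set.Ioi (n : ℝ)))) := by
          apply tendsto_measure_iInter_atTop
          · intro n; exact measurableSet_Ioi.nullMeasurableSet
          · intro m n hmn; exact Set.Ioi_subset_Ioi (by exact_mod_cast hmn)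
          · exact ⟨0, measure_ne_top _ _⟩
        have h2 : (⋂ n : ℕ, Set.Ioi (n : ℝ)) = ∅ := by
          ext x; simp only [Set.mem_iInter, Set.mem_Ioi, Set.mem_empty_iff_false, iff_false, not_forall, not_lt]
          exact exists_nat_ge x
        rw [h2, measure_empty] at h1
        have h3 := (h1.eventually (ge_mem_nhds (ENNReal.ofReal_pos.2 ht))).exists
        obtain ⟨n, hn⟩ := h3
        exact ⟨(n : ℝ≥0), by simpa [hS] using hn⟩
      constructor
      · intro h
        by_contra hc
        push Not at hc
        exact absurd (csInf_le (OrderBot.bddBelow S) (show a ∈ S from hc)) (not_le.2 h)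
      · intro h
        -- right continuity
        have h1 : Tendsto (fun n : ℕ => ν (Set.Ioi ((a : ℝ) + 1 / ((n : ℝ) + 1)))) atTop
            (𝓝 (ν (⋃ n : ℕ, Set.Ioi ((a : ℝ) + 1 / ((n : ℝ) + 1))))) := by
          apply tendsto_measure_iUnion_atTop
          intro m n hmn
          apply Set.Ioi_subset_Ioi
          have := one_div_le_one_div_of_le (by positivity : (0 : ℝ) < (m : ℝ) + 1) (by exact_mod_cast Nat.succ_le_succ hmn : (m : ℝ) + 1 ≤ (n : ℝ) + 1)
          linarith
        have h2 : (⋃ n : ℕ, Set.Ioi ((a : ℝ) + 1 / ((n : ℝ) + 1))) = Set.Ioi (a : ℝ) := by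
          ext x; simp only [Set.mem_iUnion, Set.mem_Ioi]
          constructor
          · rintro ⟨n, hn⟩
            have : (0 : ℝ) < 1 / ((n : ℝ) + 1) := by positivity
            linarith
          · intro hx
            obtain ⟨n, hn⟩ := exists_nat_one_div_lt (sub_pos.2 hx)
            exact ⟨n, by linarith⟩
        rw [h2] at h1
        obtain ⟨n, hn⟩ := (h1.eventually (lt_mem_nhds h)).exists
        have h4 : a + 1 / ((n : ℝ≥0) + 1) ≤ sInf S := by
          apply le_csInf hne
          intro b hb
          by_contra hc
          push Not at hc
          have hb' : ν (Set.Ioi (b : ℝ)) ≤ ENNReal.ofReal t := hb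
          have : Set.Ioi ((a : ℝ) + 1 / ((n : ℝ) + 1)) ⊆ Set.Ioi (b : ℝ) := by
            apply Set.Ioi_subset_Ioi
            have := hc.le
            exact_mod_cast this
          exact absurd (hn.trans_le ((measure_mono this).trans hb')) (lt_irrefl _)
        refine lt_of_lt_of_le ?_ h4
        exact lt_add_of_pos_right _ (by positivity)
    · simp [ht]
  refine ⟨fun t => if 0 < t then sInf {b : ℝ≥0 | ν (Set.Ioi (b : ℝ)) ≤ ENNReal.ofReal t} else 0, ?_, key⟩
  apply measurable_of_Ioi
  intro a
  have : (fun t : ℝ => if 0 < t then sInf {b : ℝ≥0 | ν (Set.Ioi (b : ℝ)) ≤ ENNReal.ofReal t} else 0) ⁻¹' Set.Ioi a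
      = Set.Ioi 0 ∩ (ENNReal.ofReal ⁻¹' Set.Iio (ν (Set.Ioi (a : ℝ)))) := by
    ext t
    exact key a t
  rw [this]
  exact measurableSet_Ioi.inter (ENNReal.measurable_ofReal measurableSet_Iio)

lemma volume_lt_set (x : ℝ≥0∞) (hx : x ≠ ⊤) :
    volume {t : ℝ | 0 < t ∧ ENNReal.ofReal t < x} = x := by
  have : {t : ℝ | 0 < t ∧ ENNReal.ofReal t < x} = Set.Ioo 0 x.toReal := by
    ext t
    simp only [Set.mem_ofPred_eq, Set.mem_Ioo]
    constructor
    · rintro ⟨h1, h2⟩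
      exact ⟨h1, (ENNReal.ofReal_lt_iff_lt_toReal h1.le hx).1 h2⟩
    · rintro ⟨h1, h2⟩
      exact ⟨h1, (ENNReal.ofReal_lt_iff_lt_toReal h1.le hx).2 h2⟩
  rw [this, Real.volume_Ioo, sub_zero, ENNReal.ofReal_toReal hx]

/-- Integrals of truncations only depend on the distribution. -/
lemma lintegral_trunc_eq {α β : Type*} [MeasurableSpace α] [MeasurableSpace β]
    (μ : Measure α) (ν : Measure β) (f : α → ℝ) (g : β → ℝ)
    (hf : AEMeasurable f μ) (hg : AEMeasurable g ν)
    (h : ∀ a : ℝ, 0 < a → μ {x | a < f x} = ν {x | a < g x}) (a : ℝ) (ha : 0 ≤ a) :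
    ∫⁻ x, ENNReal.ofReal (f x - a) ∂μ = ∫⁻ x, ENNReal.ofReal (g x - a) ∂ν := by
  have e1 : ∀ (y : ℝ), ENNReal.ofReal (y - a) = ENNReal.ofReal (max (y - a) 0) := by
    intro y; rw [ENNReal.ofReal_max]; simp
  simp_rw [e1]
  rw [lintegral_eq_lintegral_meas_lt μ (f := fun x => max (f x - a) 0) (Eventually.of_forall fun x => le_max_right _ _)
    ((hf.sub_const a).max aemeasurable_const),
    lintegral_eq_lintegral_meas_lt ν (f := fun x => max (g x - a) 0) (Eventually.of_forall fun x => le_max_right _ _)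
    ((hg.sub_const a).max aemeasurable_const)]
  apply setLIntegral_congr_fun measurableSet_Ioi
  intro t ht
  have ht' : (0 : ℝ) < t := ht
  have e2 : ∀ y : ℝ, t < max (y - a) 0 ↔ t + a < y := by
    intro y
    rw [lt_max_iff]
    constructor
    · rintro (h | h) <;> linarith
    · intro h; left; linarith
  simp only [e2]
  exact h (t + a) (by linarith)

/-- Hardy-Littlewood type inequality. -/
lemma hardy (ζ₀ ζ : ℝ × ℝ → ℝ) (h0i : Integrable ζ₀ μUH)
    (hnn : ∀ x, 0 ≤ ζ x) (hi : Integrable ζ μUH) (hprec : prec ζ ζ₀)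
    (h : ℝ → ℝ≥0) (hm : Measurable h)
    (hD : ∀ (a : ℝ≥0) (t : ℝ),
      a < h t ↔ (0 < t ∧ ENNReal.ofReal t < μUH {x | (a : ℝ) < ζ₀ x}))
    (hfin : ∀ a : ℝ≥0, μUH {x | (a : ℝ) < ζ₀ x} ≠ ⊤)
    (E : Set (ℝ × ℝ)) (hE : μUH E ≠ ⊤) :
    ∫⁻ x in E, ENNReal.ofReal (ζ x) ∂μUH ≤ ∫⁻ t in Set.Ioc 0 (μUH E).toReal, (h t : ℝ≥0∞) := by
  set T := (μUH E).toReal with hT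
  rcases (ENNReal.toReal_nonneg : 0 ≤ T).eq_or_lt with hT0 | hT0
  · have : μUH E = 0 := by
      rcases (ENNReal.toReal_eq_zero_iff _).1 hT0.symm with h | h
      · exact h
      · exact absurd h hE
    rw [setLIntegral_measure_zero _ _ this]
    exact zero_le
  have hET : μUH E = ENNReal.ofReal T := (ENNReal.ofReal_toReal hE).symm
  have hanti : ∀ s t : ℝ, 0 < s → s ≤ t → h t ≤ h s := by
    intro s t hs hst
    by_contra hc
    push Not at hc
    have := (hD (h s) t).1 hc
    exact lt_irrefl _ ((hD (h s) s).2 ⟨hs, (ENNReal.ofReal_le_ofReal hst).trans_lt this.2⟩)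
  have hdist : ∀ a : ℝ, 0 < a → μUH {x | a < ζ₀ x} = (volume.restrict (Set.Ioi (0:ℝ))) {t | a < (h t : ℝ)} := by
    intro a ha
    lift a to ℝ≥0 using ha.le
    have : {t | (a : ℝ) < (h t : ℝ)} = {t : ℝ | 0 < t ∧ ENNReal.ofReal t < μUH {x | (a : ℝ) < ζ₀ x}} := by
      ext t
      simp only [Set.mem_ofPred_eq, ← hD]
      exact NNReal.coe_lt_coe
    rw [Measure.restrict_eq_self _ (by rw [this]; exact fun t ht => ht.1), this, volume_lt_set _ (hfin a)]
  have main : ∀ ε : ℝ≥0, 0 < ε → ∫⁻ x in E, ENNReal.ofReal (ζ x) ∂μUH ≤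
      (∫⁻ t in Set.Ioc 0 T, (h t : ℝ≥0∞)) + ε * ENNReal.ofReal T := by
    intro ε hε
    set a : ℝ≥0 := h T + ε with ha
    have hapos : (0 : ℝ) < a := by
      have : 0 < a := by positivity
      exact_mod_cast this
    have s1 : ∫⁻ x, ENNReal.ofReal (ζ x - a) ∂μUH ≤ ∫⁻ x, ENNReal.ofReal (ζ₀ x - a) ∂μUH := by
      have e1 : ∀ (y : ℝ), ENNReal.ofReal (y - a) = ENNReal.ofReal (max (y - a) 0) := by
        intro y; rw [ENNReal.ofReal_max]; simp
      have hint : ∀ f : ℝ × ℝ → ℝ, Integrable f μUH → Integrable (fun x => max (f x - a) 0) μUH := by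
        intro f hf
        refine Integrable.mono hf ?_ ?_
        · exact ((hf.aestronglyMeasurable.aemeasurable.sub_const _).max aemeasurable_const).aestronglyMeasurable
        · refine Eventually.of_forall fun x => ?_
          rw [Real.norm_of_nonneg (le_max_right _ _), Real.norm_eq_abs]
          apply max_le _ (abs_nonneg _)
          linarith [le_abs_self (f x)]
      simp_rw [e1]
      rw [← ofReal_integral_eq_lintegral_ofReal (hint _ hi) (Eventually.of_forall fun x => le_max_right _ _),
        ← ofReal_integral_eq_lintegral_ofReal (hint _ h0i) (Eventually.of_forall fun x => le_max_right _ _)]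
      exact ENNReal.ofReal_le_ofReal (hprec a hapos)
    have s2 := lintegral_trunc_eq μUH (volume.restrict (Set.Ioi (0:ℝ))) ζ₀ (fun t => (h t : ℝ))
      h0i.aestronglyMeasurable.aemeasurable (by fun_prop) hdist a hapos.le
    have s3 : ∫⁻ t in Set.Ioi (0:ℝ), ENNReal.ofReal ((h t : ℝ) - a) = ∫⁻ t in Set.Ioc 0 T, ENNReal.ofReal ((h t : ℝ) - a) := by
      rw [← Set.Ioc_union_Ioi_eq_Ioi hT0.le, lintegral_union measurableSet_Ioi (Set.Ioc_disjoint_Ioi le_rfl)]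
      have : ∫⁻ t in Set.Ioi T, ENNReal.ofReal ((h t : ℝ) - a) = 0 := by
        rw [setLIntegral_congr_fun (g := fun _ => 0) measurableSet_Ioi]
        · simp
        · intro t ht
          have h1 : (h t : ℝ) ≤ h T := by exact_mod_cast hanti T t hT0 (le_of_lt ht)
          simp only [ha]
          apply ENNReal.ofReal_of_nonpos
          push_cast
          have : (0 : ℝ) < ε := by exact_mod_cast hε
          linarith
      rw [this, add_zero]
    calc ∫⁻ x in E, ENNReal.ofReal (ζ x) ∂μUH
        ≤ ∫⁻ x in E, ((a : ℝ≥0∞) + ENNReal.ofReal (ζ x - a)) ∂μUH := by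
          apply lintegral_mono
          intro x
          calc ENNReal.ofReal (ζ x) = ENNReal.ofReal (a + (ζ x - a)) := by ring_nf
            _ ≤ ENNReal.ofReal a + ENNReal.ofReal (ζ x - a) := ENNReal.ofReal_add_le
            _ = _ := by simp
      _ = a * ENNReal.ofReal T + ∫⁻ x in E, ENNReal.ofReal (ζ x - a) ∂μUH := by
          rw [lintegral_add_left measurable_const]; simp [hET]
      _ ≤ a * ENNReal.ofReal T + ∫⁻ t in Set.Ioc 0 T, ENNReal.ofReal ((h t : ℝ) - a) := by
          gcongr
          rw [← s3, ← s2]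
          exact (setLIntegral_le_lintegral _ _).trans s1
      _ = ∫⁻ t in Set.Ioc 0 T, ((a : ℝ≥0∞) + ENNReal.ofReal ((h t : ℝ) - a)) := by
          rw [lintegral_add_left measurable_const]; simp
      _ ≤ ∫⁻ t in Set.Ioc 0 T, ((h t : ℝ≥0∞) + ε) := by
          apply setLIntegral_mono' measurableSet_Ioc
          intro t ht
          have h1 : h T ≤ h t := hanti t T ht.1 ht.2
          have e : ENNReal.ofReal ((h t : ℝ) - a) = ((h t - a : ℝ≥0) : ℝ≥0∞) := by
            rw [ENNReal.ofReal, ENNReal.coe_inj, NNReal.sub_def]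
          rw [e]
          norm_cast
          rw [add_tsub_eq_max]
          exact max_le (by rw [ha]; gcongr) (by simp)
      _ = _ := by
          rw [lintegral_add_right _ measurable_const]; simp
  have hlim : Tendsto (fun ε : ℝ≥0 => (∫⁻ t in Set.Ioc 0 T, (h t : ℝ≥0∞)) + ε * ENNReal.ofReal T) (𝓝[>] 0)
      (𝓝 ((∫⁻ t in Set.Ioc 0 T, (h t : ℝ≥0∞)) + (0 : ℝ≥0) * ENNReal.ofReal T)) := by
    apply Tendsto.mono_left _ nhdsWithin_le_nhds
    apply Tendsto.const_add
    apply ENNReal.Tendsto.mul_const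
    · exact ENNReal.tendsto_coe.2 tendsto_id
    · right; simp
  have := ge_of_tendsto hlim (eventually_nhdsWithin_of_forall main)
  simpa using this

/-- Remove the interval `(s, s+q]` from the domain of `h`. -/
def cutFun (h : ℝ → ℝ≥0) (s q : ℝ) (t : ℝ) : ℝ≥0 := if t ≤ s then h t else h (t + q)

lemma shift_setLIntegral (g : ℝ → ℝ≥0∞) (q : ℝ) (S : Set ℝ) :
    ∫⁻ t in (fun t => t + q) ⁻¹' S, g (t + q) = ∫⁻ t in S, g t :=
  (measurePreserving_add_right volume q).setLIntegral_comp_preimage_emb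
    (measurableEmbedding_addRight q) g S

lemma shift_setLIntegral' (g : ℝ → ℝ≥0∞) (q : ℝ) (S : Set ℝ) :
    ∫⁻ t in (fun t => q + t) ⁻¹' S, g (q + t) = ∫⁻ t in S, g t :=
  (measurePreserving_add_left volume q).setLIntegral_comp_preimage_emb
    (measurableEmbedding_addLeft q) g S

lemma cutFun_total (h : ℝ → ℝ≥0) (s q : ℝ) (hq : 0 ≤ q) (F : ℝ≥0 → ℝ≥0∞) (hF : Measurable F)
    (hm : Measurable h) :
    ∫⁻ t, F (h t) = (∫⁻ t in Set.Ioc 0 q, F (h (s + t))) + ∫⁻ t, F (cutFun h s q t) := by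
  have e0 : ∫⁻ t in Set.Ioc 0 q, F (h (s + t)) = ∫⁻ t in Set.Ioc s (s + q), F (h t) := by
    rw [← shift_setLIntegral' _ s (Set.Ioc s (s + q))]
    have : (fun t => s + t) ⁻¹' Set.Ioc s (s + q) = Set.Ioc 0 q := by
      ext x; simp
    rw [this]
  have e1 : ∫⁻ x, F (cutFun h s q x) = (∫⁻ x in Set.Iic s, F (h x))
      + ∫⁻ x in Set.Ioi (s + q), F (h x) := by
    rw [← setLIntegral_univ, ← Set.Iic_union_Ioi (a := s),
      lintegral_union measurableSet_Ioi (Set.Iic_disjoint_Ioi le_rfl)]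
    congr 1
    · apply setLIntegral_congr_fun measurableSet_Iic
      intro x hx
      have hx : x ≤ s := hx
      simp [cutFun, hx]
    · rw [← shift_setLIntegral _ q (Set.Ioi (s + q))]
      have : (fun t => t + q) ⁻¹' Set.Ioi (s + q) = Set.Ioi s := by
        ext x; simp
      rw [this]
      apply setLIntegral_congr_fun measurableSet_Ioi
      intro x hx
      have hx : ¬ x ≤ s := not_le.2 hx
      simp [cutFun, hx]
  rw [e0, e1, ← setLIntegral_univ, ← Set.Iic_union_Ioi (a := s + q),
      lintegral_union measurableSet_Ioi (Set.Iic_disjoint_Ioi le_rfl),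
      ← Set.Iic_union_Ioc_eq_Iic (show s ≤ s + q by linarith),
      lintegral_union measurableSet_Ioc (Set.Iic_disjoint_Ioc le_rfl)]
  ring

lemma cutFun_Iic (h : ℝ → ℝ≥0) (s q t : ℝ) (hq : 0 ≤ q) (hst : s ≤ t) :
    ∫⁻ x in Set.Iic (t + q), (h x : ℝ≥0∞) = (∫⁻ x in Set.Ioc s (s + q), (h x : ℝ≥0∞))
      + ∫⁻ x in Set.Iic t, (cutFun h s q x : ℝ≥0∞) := by
  have e1 : ∫⁻ x in Set.Iic t, (cutFun h s q x : ℝ≥0∞) = (∫⁻ x in Set.Iic s, (h x : ℝ≥0∞))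
      + ∫⁻ x in Set.Ioc (s + q) (t + q), (h x : ℝ≥0∞) := by
    rw [← Set.Iic_union_Ioc_eq_Iic hst, lintegral_union measurableSet_Ioc (Set.Iic_disjoint_Ioc le_rfl)]
    congr 1
    · apply setLIntegral_congr_fun measurableSet_Iic
      intro x hx
      have hx : x ≤ s := hx
      simp [cutFun, hx]
    · rw [← shift_setLIntegral _ q (Set.Ioc (s + q) (t + q))]
      have : (fun t => t + q) ⁻¹' Set.Ioc (s + q) (t + q) = Set.Ioc s t := by
        ext x; simp
      rw [this]
      apply setLIntegral_congr_fun measurableSet_Ioc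
      intro x hx
      have hx : ¬ x ≤ s := not_le.2 hx.1
      simp [cutFun, hx]
  rw [e1, ← Set.Iic_union_Ioc_eq_Iic (show s + q ≤ t + q by linarith),
    lintegral_union measurableSet_Ioc (Set.Iic_disjoint_Ioc le_rfl),
    ← Set.Iic_union_Ioc_eq_Iic (show s ≤ s + q by linarith),
    lintegral_union measurableSet_Ioc (Set.Iic_disjoint_Ioc le_rfl)]
  ring

lemma exists_cut (h : ℝ → ℝ≥0) (hm : Measurable h) (hfin : ∫⁻ t, (h t : ℝ≥0∞) ≠ ⊤) (M : ℝ)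
    (hneg : ∀ t, t ≤ 0 → h t = 0) (hM : ∀ t, M < t → h t = 0) (q : ℝ) (hq : 0 ≤ q) (c : ℝ≥0∞)
    (hc : c ≤ ∫⁻ t in Set.Iic q, (h t : ℝ≥0∞)) :
    ∃ s, 0 ≤ s ∧ ∫⁻ t in Set.Ioc s (s + q), (h t : ℝ≥0∞) = c := by
  have hint : Integrable (fun t => (h t : ℝ)) volume := by
    refine ⟨by fun_prop, ?_⟩
    rw [hasFiniteIntegral_iff_enorm]
    simpa using hfin.lt_top
  set Φ : ℝ → ℝ := fun s => (∫ x in (0:ℝ)..(s + q), (h x : ℝ)) - ∫ x in (0:ℝ)..s, (h x : ℝ) with hΦ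
  have hcont : Continuous Φ := by
    have := intervalIntegral.continuous_primitive (f := fun t => (h t : ℝ)) (μ := volume)
      (fun a b => hint.intervalIntegrable) 0
    exact (this.comp (continuous_id.add continuous_const)).sub this
  have hΦe : ∀ s, ENNReal.ofReal (Φ s) = ∫⁻ t in Set.Ioc s (s + q), (h t : ℝ≥0∞) := by
    intro s
    have : Φ s = ∫ x in Set.Ioc s (s + q), (h x : ℝ) := by
      rw [← intervalIntegral.integral_of_le (by linarith)]
      exact intervalIntegral.integral_interval_sub_left hint.intervalIntegrable hint.intervalIntegrable
    rw [this, ofReal_integral_eq_lintegral_ofReal hint.integrableOn (Eventually.of_forall fun x => NNReal.coe_nonneg _)]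
    simp
  have hctop : c ≠ ⊤ := ne_top_of_le_ne_top hfin (hc.trans (setLIntegral_le_lintegral _ _))
  have h0 : c.toReal ≤ Φ 0 := by
    have : Φ 0 ≥ 0 := by
      simp only [hΦ, intervalIntegral.integral_same, sub_zero, zero_add]
      exact intervalIntegral.integral_nonneg hq (fun x _ => NNReal.coe_nonneg _)
    rw [← ENNReal.ofReal_le_ofReal_iff this, hΦe, ENNReal.ofReal_toReal hctop, zero_add]
    refine hc.trans ?_
    rw [← Set.Iic_union_Ioc_eq_Iic hq, lintegral_union measurableSet_Ioc (Set.Iic_disjoint_Ioc le_rfl)]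
    rw [setLIntegral_congr_fun (g := fun _ => 0) measurableSet_Iic]
    · simp
    · intro x hx; simp [hneg x hx]
  have hM0 : Φ (max M 0) = 0 := by
    simp only [hΦ]
    rw [intervalIntegral.integral_interval_sub_left hint.intervalIntegrable hint.intervalIntegrable]
    rw [intervalIntegral.integral_of_le (by linarith)]
    apply setIntegral_eq_zero_of_forall_eq_zero
    intro x hx
    simp [hM x ((le_max_left _ _).trans_lt hx.1)]
  obtain ⟨s, hs, hsc⟩ := intermediate_value_Icc' (le_max_right M 0) hcont.continuousOn
    (show c.toReal ∈ Set.Icc (Φ (max M 0)) (Φ 0) from ⟨by rw [hM0]; exact ENNReal.toReal_nonneg, h0⟩)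
  refine ⟨s, hs.1, ?_⟩
  rw [← hΦe, hsc, ENNReal.ofReal_toReal hctop]

/-- The invariant of the greedy construction. -/
structure CutInv {α : Type*} [MeasurableSpace α] (μ : Measure α) (f : α → ℝ≥0∞) (M : ℝ) (S : Set α)
    (h : ℝ → ℝ≥0) : Prop where
  meas : Measurable h
  fin : ∫⁻ t, (h t : ℝ≥0∞) ≠ ⊤
  neg : ∀ t, t ≤ 0 → h t = 0
  big : ∀ t, M < t → h t = 0
  dom : ∀ E, E ⊆ S → MeasurableSet E → μ E ≠ ⊤ → ∫⁻ x in E, f x ∂μ ≤ ∫⁻ t in Set.Iic (μ E).toReal, (h t : ℝ≥0∞)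

lemma cut_step {α : Type*} [MeasurableSpace α] (μ : Measure α) (f : α → ℝ≥0∞) (M : ℝ) (S : Set α)
    (h : ℝ → ℝ≥0) (hI : CutInv μ f M S h) (C : Set α) (hC : MeasurableSet C) (hCS : C ⊆ S) (hμC : μ C ≠ ⊤) :
    ∃ (h' d : ℝ → ℝ≥0), CutInv μ f M (S \ C) h' ∧ Measurable d ∧
      ∫⁻ t in Set.Ioc 0 (μ C).toReal, (d t : ℝ≥0∞) = ∫⁻ x in C, f x ∂μ ∧
      ∀ F : ℝ≥0 → ℝ≥0∞, Measurable F → ∫⁻ t, F (h t) = (∫⁻ t in Set.Ioc 0 (μ C).toReal, F (d t)) + ∫⁻ t, F (h' t) := by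
  set q := (μ C).toReal with hq
  have hq0 : 0 ≤ q := ENNReal.toReal_nonneg
  obtain ⟨s, hs, hsc⟩ := exists_cut h hI.meas hI.fin M hI.neg hI.big q hq0 _ (hI.dom C hCS hC hμC)
  have htot := fun F hF => cutFun_total h s q hq0 F hF hI.meas
  have hcm : Measurable (cutFun h s q) :=
    Measurable.ite measurableSet_Iic hI.meas (hI.meas.comp (measurable_id.add_const q))
  refine ⟨cutFun h s q, fun t => h (s + t), ⟨hcm, ?_, ?_, ?_, ?_⟩,
    hI.meas.comp (measurable_id.const_add s), ?_, htot⟩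
  · refine ne_top_of_le_ne_top hI.fin ?_
    rw [htot (fun y => (y : ℝ≥0∞)) measurable_coe_nnreal_ennreal]
    exact le_add_self
  · intro t ht
    simp [cutFun, ht.trans hs, hI.neg t ht]
  · intro t ht
    unfold cutFun
    split_ifs
    · exact hI.big t ht
    · exact hI.big _ (by linarith)
  · intro E hES hE hμE
    rcases le_total (μ E).toReal s with hle | hle
    · refine (hI.dom E (hES.trans Set.sdiff_subset) hE hμE).trans (le_of_eq ?_)
      apply setLIntegral_congr_fun measurableSet_Iic
      intro x hx
      have hx : x ≤ s := (show x ≤ _ from hx).trans hle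
      simp [cutFun, hx]
    · have hd : Disjoint E C := Set.disjoint_of_subset_left hES Set.disjoint_sdiff_left
      have h1 := hI.dom (E ∪ C) (Set.union_subset (hES.trans Set.sdiff_subset) hCS) (hE.union hC)
        (by rw [measure_union hd hC]; exact ENNReal.add_ne_top.2 ⟨hμE, hμC⟩)
      rw [measure_union hd hC, ENNReal.toReal_add hμE hμC, lintegral_union hC hd, ← hq,
        cutFun_Iic h s q _ hq0 hle, hsc, add_comm] at h1
      refine (ENNReal.add_le_add_iff_left ?_).1 h1
      rw [← hsc]
      exact ne_top_of_le_ne_top hI.fin (setLIntegral_le_lintegral _ _)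
  · rw [← hsc, ← shift_setLIntegral' _ s (Set.Ioc s (s + q))]
    have : (fun t => s + t) ⁻¹' Set.Ioc s (s + q) = Set.Ioc 0 q := by
      ext x; simp
    rw [this]

/-- The greedy construction. -/
lemma cut_seq {α : Type*} [MeasurableSpace α] (μ : Measure α) (f : α → ℝ≥0∞) (M : ℝ)
    (h : ℝ → ℝ≥0) (hI : CutInv μ f M Set.univ h) (C : ℕ → Set α) (hC : ∀ i, MeasurableSet (C i))
    (hdisj : Pairwise (Function.onFun Disjoint C)) (hμC : ∀ i, μ (C i) ≠ ⊤) :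
    ∃ (d : ℕ → ℝ → ℝ≥0), (∀ i, Measurable (d i)) ∧
      (∀ i, ∫⁻ t in Set.Ioc 0 (μ (C i)).toReal, (d i t : ℝ≥0∞) = ∫⁻ x in C i, f x ∂μ) ∧
      ∀ F : ℝ≥0 → ℝ≥0∞, Measurable F → ∑' i, ∫⁻ t in Set.Ioc 0 (μ (C i)).toReal, F (d i t) ≤ ∫⁻ t, F (h t) := by
  set S : ℕ → Set α := fun n => (⋃ i ∈ Set.Iio n, C i)ᶜ with hS
  have hSs : ∀ n, S (n + 1) = S n \ C n := by
    intro n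
    simp only [hS]
    ext x
    simp only [Set.mem_compl_iff, Set.mem_iUnion, not_exists, Set.mem_sdiff, Set.mem_Iio]
    constructor
    · intro hx
      exact ⟨fun i hi => hx i (by omega), hx n (by omega)⟩
    · rintro ⟨h1, h2⟩ i hi
      rcases (Nat.lt_succ_iff_lt_or_eq.1 hi) with h | h
      · exact h1 i h
      · rw [h]; exact h2
  have hCS : ∀ n, C n ⊆ S n := by
    intro n x hx
    simp only [hS, Set.mem_compl_iff, Set.mem_iUnion, not_exists, Set.mem_Iio]
    intro i hi hxi
    exact Set.disjoint_left.1 (hdisj hi.ne) hxi hx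
  have step : ∀ n (h : {h : ℝ → ℝ≥0 // CutInv μ f M (S n) h}), ∃ (h' : {h : ℝ → ℝ≥0 // CutInv μ f M (S (n+1)) h})
      (d : ℝ → ℝ≥0), Measurable d ∧
      ∫⁻ t in Set.Ioc 0 (μ (C n)).toReal, (d t : ℝ≥0∞) = ∫⁻ x in C n, f x ∂μ ∧
      ∀ F : ℝ≥0 → ℝ≥0∞, Measurable F → ∫⁻ t, F (h.1 t) = (∫⁻ t in Set.Ioc 0 (μ (C n)).toReal, F (d t)) + ∫⁻ t, F (h'.1 t) := by
    rintro n ⟨h, hh⟩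
    obtain ⟨h', d, h1, h2⟩ := cut_step μ f M (S n) h hh (C n) (hC n) (hCS n) (hμC n)
    exact ⟨⟨h', by rw [hSs]; exact h1⟩, d, h2⟩
  choose nxt dd hd1 hd2 hd3 using step
  have hI0 : CutInv μ f M (S 0) h := by
    have : S 0 = Set.univ := by simp [hS]
    rw [this]; exact hI
  let H : ∀ n, {h : ℝ → ℝ≥0 // CutInv μ f M (S n) h} := fun n => Nat.rec ⟨h, hI0⟩ (fun n h => nxt n h) n
  refine ⟨fun n => dd n (H n), fun n => hd1 _ _, fun n => hd2 _ _, ?_⟩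
  intro F hF
  have hsum : ∀ n, ∫⁻ t, F (h t) = (∑ i ∈ Finset.range n, ∫⁻ t in Set.Ioc 0 (μ (C i)).toReal, F (dd i (H i) t))
      + ∫⁻ t, F ((H n).1 t) := by
    intro n
    induction n with
    | zero => simp [H]
    | succ n ih =>
      rw [ih, Finset.sum_range_succ, hd3 n (H n) F hF, add_assoc]
  apply ENNReal.tsum_le_of_sum_range_le
  intro n
  rw [hsum n]
  exact le_self_add

lemma build (ζ₀ : ℝ × ℝ → ℝ) (f : ℝ × ℝ → ℝ≥0∞) (h : ℝ → ℝ≥0) (M M' : ℝ)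
    (hD : ∀ (a : ℝ≥0) (t : ℝ),
      a < h t ↔ (0 < t ∧ ENNReal.ofReal t < μUH {x | (a : ℝ) < ζ₀ x}))
    (h0M : μUH {x | 0 < ζ₀ x} ≤ ENNReal.ofReal M)
    (hI : CutInv μUH f M' Set.univ h) (C : ℕ → Set (ℝ × ℝ)) (hC : ∀ i, MeasurableSet (C i))
    (hdisj : Pairwise (Function.onFun Disjoint C)) (hμC : ∀ i, μUH (C i) ≠ ⊤)
    (hU : ∀ᵐ x ∂μUH, x ∈ ⋃ i, C i)
    (u : ℕ → ℝ × ℝ → ℝ) (hum : ∀ i, Measurable (u i))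
    (hu : ∀ i, (μUH.restrict (C i)).map (u i) = volume.restrict (Set.Ioc 0 (μUH (C i)).toReal))
    (J : Set ℕ) (hJ : ∀ i ∈ J, ∫⁻ x in C i, f x ∂μUH = 0)
    (v : ℝ × ℝ → ℝ) (hvm : Measurable v)
    (hv : (μUH.restrict (⋃ i ∈ J, C i)).map v = volume.restrict (Set.Ioc 0 M)) :
    ∃ η : ℝ × ℝ → ℝ≥0, Measurable η ∧ memRplus ζ₀ (fun x => (η x : ℝ)) ∧
      (∀ i, ∫⁻ x in C i, (η x : ℝ≥0∞) ∂μUH = ∫⁻ x in C i, f x ∂μUH) ∧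
      (∀ a : ℝ, 0 < a → μUH {x | a < (η x : ℝ)} ≤ μUH {x | a < ζ₀ x}) := by
  classical
  obtain ⟨d, hdm, hdi, hdF⟩ := cut_seq μUH f M' h hI C hC hdisj hμC
  set B := ⋃ i ∈ J, C i with hB
  have hBm : MeasurableSet B := MeasurableSet.biUnion (Set.to_countable J) (fun i _ => hC i)
  have hfin : ∀ a : ℝ≥0, μUH {x | (a : ℝ) < ζ₀ x} ≠ ⊤ := fun a =>
    ne_top_of_le_ne_top ENNReal.ofReal_ne_top ((measure_mono (fun x (hx : (a:ℝ) < ζ₀ x) =>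
      lt_of_le_of_lt a.coe_nonneg hx)).trans h0M)
  -- measures
  set ν₀ : Measure ℝ := (volume.map (fun t => (h t : ℝ))).restrict (Set.Ioi 0) with hν₀
  set ν : ℕ → Measure ℝ := fun i => ((volume.restrict (Set.Ioc 0 (μUH (C i)).toReal)).map
    (fun t => (d i t : ℝ))).restrict (Set.Ioi 0) with hν
  have hhm : Measurable (fun t => (h t : ℝ)) := hI.meas.coe_nnreal_real
  have hdm' : ∀ i, Measurable (fun t => (d i t : ℝ)) := fun i => (hdm i).coe_nnreal_real
  have hν₀Ioi : ∀ a : ℝ≥0, ν₀ (Set.Ioi (a : ℝ)) = μUH {x | (a : ℝ) < ζ₀ x} := by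
    intro a
    rw [hν₀, Measure.restrict_apply measurableSet_Ioi, Measure.map_apply hhm (measurableSet_Ioi.inter measurableSet_Ioi)]
    rw [← volume_lt_set _ (hfin a)]
    congr 1
    ext t
    simp only [Set.mem_preimage, Set.mem_inter_iff, Set.mem_Ioi, Set.mem_ofPred_eq, ← hD]
    constructor
    · intro h; exact_mod_cast h.1
    · intro h; exact ⟨by exact_mod_cast h, by exact_mod_cast lt_of_le_of_lt (zero_le) h⟩
  have hν₀univ : ν₀ Set.univ ≤ ENNReal.ofReal M := by
    have h1 : ν₀ Set.univ = ν₀ (Set.Ioi ((0 : ℝ≥0) : ℝ)) := by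
      rw [hν₀]; simp
    rw [h1, hν₀Ioi]
    simpa using h0M
  have : IsFiniteMeasure ν₀ := ⟨hν₀univ.trans_lt ENNReal.ofReal_lt_top⟩
  have hle : Measure.sum ν ≤ ν₀ := by
    rw [Measure.le_iff]
    intro A hA
    rw [Measure.sum_apply _ hA]
    have hA' : MeasurableSet ((fun y : ℝ≥0 => (y : ℝ)) ⁻¹' (A ∩ Set.Ioi 0)) :=
      measurable_coe_nnreal_real (hA.inter measurableSet_Ioi)
    have := hdF (((fun y : ℝ≥0 => (y : ℝ)) ⁻¹' (A ∩ Set.Ioi 0)).indicator 1) (measurable_one.indicator hA')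
    convert this using 1
    · congr 1
      ext i
      rw [hν, Measure.restrict_apply hA, Measure.map_apply (hdm' i) (hA.inter measurableSet_Ioi)]
      rw [← lintegral_indicator_one ((hdm' i) (hA.inter measurableSet_Ioi))]
      rfl
    · rw [hν₀, Measure.restrict_apply hA, Measure.map_apply hhm (hA.inter measurableSet_Ioi)]
      rw [← lintegral_indicator_one (hhm (hA.inter measurableSet_Ioi))]
      rfl
  have : IsFiniteMeasure (Measure.sum ν) := isFiniteMeasure_of_le ν₀ hle
  set ρ := ν₀ - Measure.sum ν with hρ
  have hρle : ρ ≤ ν₀ := Measure.sub_le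
  have : IsFiniteMeasure ρ := isFiniteMeasure_of_le ν₀ hρle
  have hρadd : ρ + Measure.sum ν = ν₀ := Measure.sub_add_cancel_of_le hle
  obtain ⟨e, hem, heq⟩ := exists_quantile ρ
  have hem' : Measurable (fun t => (e t : ℝ)) := hem.coe_nnreal_real
  have heM : ∀ a : ℝ≥0, (volume.restrict (Set.Ioc 0 M)) {t | (a : ℝ) < e t} = ρ (Set.Ioi (a : ℝ)) := by
    intro a
    have hs : {t | (a : ℝ) < e t} = {t | 0 < t ∧ ENNReal.ofReal t < ρ (Set.Ioi (a : ℝ))} := by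
      ext t
      simp only [Set.mem_ofPred_eq, ← heq]
      exact NNReal.coe_lt_coe
    rw [Measure.restrict_eq_self, hs, volume_lt_set _ (measure_ne_top _ _)]
    rw [hs]
    rintro t ⟨h1, h2⟩
    refine ⟨h1, ?_⟩
    have h3 : ENNReal.ofReal t < ENNReal.ofReal M :=
      h2.trans_le (((measure_mono (Set.subset_univ _)).trans (hρle _)).trans hν₀univ)
    exact ((ENNReal.ofReal_lt_ofReal_iff_of_nonneg h1.le).1 h3).le
  -- the function
  obtain ⟨ξ, hξm, hξ⟩ := exists_measurable_piecewise C hC (fun i => if i ∈ J then fun x => e (v x) else fun x => d i (u i x))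
    (by
      intro i
      split_ifs
      · exact hem.comp hvm
      · exact (hdm i).comp (hum i))
    (by
      intro i j hij x hx
      exact absurd hx.2 (Set.disjoint_left.1 (hdisj hij) hx.1))
  have hξJ : ∀ i ∈ J, ∀ x ∈ C i, ξ x = e (v x) := by
    intro i hi x hx
    have := hξ i hx
    simpa [hi] using this
  have hξJ' : ∀ i ∉ J, ∀ x ∈ C i, ξ x = d i (u i x) := by
    intro i hi x hx
    have := hξ i hx
    simpa [hi] using this
  have hξB : ∀ x ∈ B, ξ x = e (v x) := by
    intro x hx
    simp only [hB, Set.mem_iUnion] at hx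
    obtain ⟨i, hi, hx⟩ := hx
    exact hξJ i hi x hx
  have hnotB : ∀ i ∉ J, ∀ x ∈ C i, x ∉ B := by
    intro i hi x hx hxB
    simp only [hB, Set.mem_iUnion] at hxB
    obtain ⟨j, hj, hxj⟩ := hxB
    have : i ≠ j := fun h => hi (h ▸ hj)
    exact Set.disjoint_left.1 (hdisj this) hx hxj
  set η : ℝ × ℝ → ℝ≥0 := Bᶜ.indicator ξ with hη
  have hηm : Measurable η := hξm.indicator hBm.compl
  have hη1 : ∀ i ∈ J, ∀ x ∈ C i, η x = 0 := by
    intro i hi x hx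
    have : x ∈ B := by simp only [hB, Set.mem_iUnion]; exact ⟨i, hi, hx⟩
    simp [hη, this]
  have hη2 : ∀ i ∉ J, ∀ x ∈ C i, η x = d i (u i x) := by
    intro i hi x hx
    have := hnotB i hi x hx
    simp [hη, this, hξJ' i hi x hx]
  -- vanishing of d i for i ∈ J
  have hd0 : ∀ i ∈ J, ∀ᵐ t ∂(volume.restrict (Set.Ioc 0 (μUH (C i)).toReal)), d i t = 0 := by
    intro i hi
    have h1 := hdi i
    rw [hJ i hi, lintegral_eq_zero_iff (hdm i).coe_nnreal_ennreal] at h1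
    filter_upwards [h1] with t ht
    simpa using ht
  -- transfer of integrals over cells
  have htrans : ∀ i ∉ J, ∀ F : ℝ≥0 → ℝ≥0∞, Measurable F → ∫⁻ x in C i, F (η x) ∂μUH =
      ∫⁻ t in Set.Ioc 0 (μUH (C i)).toReal, F (d i t) := by
    intro i hi F hF
    rw [← hu i, lintegral_map (f := fun t => F (d i t)) (hF.comp (hdm i)) (hum i)]
    apply setLIntegral_congr_fun (hC i)
    intro x hx
    simp only [hη2 i hi x hx]
  have hηcell : ∀ i, ∫⁻ x in C i, (η x : ℝ≥0∞) ∂μUH = ∫⁻ x in C i, f x ∂μUH := by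
    intro i
    by_cases hi : i ∈ J
    · rw [hJ i hi, setLIntegral_congr_fun (g := fun _ => 0) (hC i)]
      · simp
      · intro x hx; simp [hη1 i hi x hx]
    · rw [← hdi i]
      exact htrans i hi (fun y => (y : ℝ≥0∞)) measurable_coe_nnreal_ennreal
  have hηdist : ∀ a : ℝ≥0, μUH {x | (a : ℝ) < η x} = (Measure.sum ν) (Set.Ioi (a : ℝ)) := by
    intro a
    have hSm : MeasurableSet {x | (a : ℝ) < η x} := measurableSet_lt measurable_const hηm.coe_nnreal_real
    have h1 : μUH {x | (a : ℝ) < η x} = μUH (⋃ i, {x | (a : ℝ) < η x} ∩ C i) := by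
      apply measure_congr
      filter_upwards [hU] with x hx
      rw [Set.mem_iUnion] at hx
      apply propext
      change (a : ℝ) < η x ↔ x ∈ ⋃ i, {x | (a : ℝ) < η x} ∩ C i
      simp only [Set.mem_iUnion, Set.mem_inter_iff, Set.mem_ofPred_eq, exists_and_left, hx, and_true]
    rw [h1, measure_iUnion (fun i j hij => (hdisj hij).mono Set.inter_subset_right Set.inter_subset_right)
      (fun i => hSm.inter (hC i)), Measure.sum_apply _ measurableSet_Ioi]
    congr 1
    ext i
    have h2 : ν i (Set.Ioi (a : ℝ)) = (volume.restrict (Set.Ioc 0 (μUH (C i)).toReal)) {t | (a : ℝ) < d i t} := by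
      rw [hν, Measure.restrict_apply measurableSet_Ioi, Measure.map_apply (hdm' i) (measurableSet_Ioi.inter measurableSet_Ioi)]
      congr 1
      ext t
      simp only [Set.mem_preimage, Set.mem_inter_iff, Set.mem_Ioi, Set.mem_ofPred_eq, and_iff_left_iff_imp]
      intro h
      exact lt_of_le_of_lt a.coe_nonneg h
    rw [h2]
    by_cases hi : i ∈ J
    · have e1 : {x | (a : ℝ) < η x} ∩ C i = ∅ := by
        ext x
        simp only [Set.mem_inter_iff, Set.mem_ofPred_eq, Set.mem_empty_iff_false, iff_false, not_and]
        intro h hx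
        rw [hη1 i hi x hx] at h
        exact absurd h (not_lt.2 a.coe_nonneg)
      rw [e1, measure_empty]
      symm
      rw [measure_eq_zero_iff_ae_notMem]
      filter_upwards [hd0 i hi] with t ht
      simp [ht]
    · rw [← hu i, Measure.map_apply (hum i) (measurableSet_lt measurable_const (hdm' i))]
      rw [Measure.restrict_apply (hum i (measurableSet_lt measurable_const (hdm' i)))]
      congr 1
      ext x
      simp only [Set.mem_inter_iff, Set.mem_ofPred_eq, Set.mem_preimage]
      constructor
      · rintro ⟨h1, h2⟩; rw [hη2 i hi x h2] at h1; exact ⟨h1, h2⟩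
      · rintro ⟨h1, h2⟩; rw [hη2 i hi x h2]; exact ⟨h1, h2⟩
  have hξdist : ∀ a : ℝ≥0, μUH {x | (a : ℝ) < ξ x} = ν₀ (Set.Ioi (a : ℝ)) := by
    intro a
    have hSm : MeasurableSet {x | (a : ℝ) < ξ x} := measurableSet_lt measurable_const hξm.coe_nnreal_real
    rw [← hρadd, Measure.add_apply, ← hηdist, ← heM, ← hv,
      Measure.map_apply hvm (measurableSet_lt measurable_const hem'),
      Measure.restrict_apply (hvm (measurableSet_lt measurable_const hem')),
      ← measure_inter_add_sdiff _ hBm]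
    congr 2
    · ext x
      simp only [Set.mem_inter_iff, Set.mem_ofPred_eq, Set.mem_preimage]
      constructor
      · rintro ⟨h1, h2⟩; rw [hξB x h2] at h1; exact ⟨h1, h2⟩
      · rintro ⟨h1, h2⟩; rw [hξB x h2]; exact ⟨h1, h2⟩
    · ext x
      simp only [Set.mem_sdiff, Set.mem_ofPred_eq, hη]
      by_cases hx : x ∈ B
      · simp [hx]
      · simp [hx]
  refine ⟨η, hηm, ⟨fun x => ξ x, Bᶜ, ?_, hBm.compl, ?_⟩, hηcell, ?_⟩
  · intro a ha
    lift a to ℝ≥0 using ha.le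
    rw [hξdist, hν₀Ioi]
  · ext x
    by_cases hx : x ∈ B <;> simp [hη, hx]
  · intro a ha
    lift a to ℝ≥0 using ha.le
    rw [hηdist, ← hν₀Ioi]
    exact hle _

lemma map_affine (a b L : ℝ) (hL : 0 < L) :
    (volume.restrict (Set.Ioc a b)).map (fun t => L * (t - a)) =
      ENNReal.ofReal L⁻¹ • volume.restrict (Set.Ioc 0 (L * (b - a))) := by
  have hm : Measurable (fun t : ℝ => L * (t - a)) := by fun_prop
  have h1 : (fun t : ℝ => L * (t - a)) ⁻¹' (Set.Ioc 0 (L * (b - a))) = Set.Ioc a b := by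
    ext t
    simp only [Set.mem_preimage, Set.mem_Ioc]
    rw [mul_pos_iff_of_pos_left hL, mul_le_mul_iff_right₀ hL]
    constructor <;> rintro ⟨h1, h2⟩ <;> constructor <;> linarith
  have h2 : volume.map (fun t : ℝ => L * (t - a)) = ENNReal.ofReal L⁻¹ • volume := by
    have : (fun t : ℝ => L * (t - a)) = (fun t => L * t) ∘ (fun t => t + (-a)) := by
      ext t; simp [sub_eq_add_neg]
    rw [this, ← Measure.map_map (by fun_prop) (by fun_prop), map_add_right_eq_self, Real.map_volume_mul_left hL.ne']
    rw [abs_of_pos (inv_pos.2 hL)]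
  rw [← h1, ← Measure.restrict_map hm measurableSet_Ioc, h2, Measure.restrict_smul]

lemma measurableSet_UHP : MeasurableSet UHP := measurableSet_lt measurable_const measurable_snd

lemma map_rect (a b c d : ℝ) (hc : 0 ≤ c) (hcd : c < d) :
    (μUH.restrict (Set.Ioc a b ×ˢ Set.Ioc c d)).map (fun x => (d - c) * (x.1 - a)) =
      volume.restrict (Set.Ioc 0 ((d - c) * (b - a))) := by
  have hsub : (Set.Ioc a b ×ˢ Set.Ioc c d) ∩ UHP = Set.Ioc a b ×ˢ Set.Ioc c d := by
    apply Set.inter_eq_left.2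
    rintro x ⟨_, h2⟩
    exact lt_of_le_of_lt hc h2.1
  have e1 : μUH.restrict (Set.Ioc a b ×ˢ Set.Ioc c d) =
      (volume.restrict (Set.Ioc a b)).prod (volume.restrict (Set.Ioc c d)) := by
    rw [μUH, Measure.restrict_restrict (measurableSet_Ioc.prod measurableSet_Ioc), hsub,
      Measure.prod_restrict]
    rfl
  have e2 : (fun x : ℝ × ℝ => (d - c) * (x.1 - a)) = (fun t => (d - c) * (t - a)) ∘ Prod.fst := rfl
  have hL : 0 < d - c := sub_pos.2 hcd
  rw [e1, e2, ← Measure.map_map (by fun_prop) measurable_fst, Measure.map_fst_prod,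
    Measure.map_smul, map_affine a b _ hL, Measure.restrict_apply_univ, Real.volume_Ioc, smul_smul,
    ← ENNReal.ofReal_mul hL.le, mul_inv_cancel₀ hL.ne']
  simp

lemma meas_rect (a b c d : ℝ) (hc : 0 ≤ c) (hab : a ≤ b) (hcd : c < d) :
    μUH (Set.Ioc a b ×ˢ Set.Ioc c d) = ENNReal.ofReal ((d - c) * (b - a)) := by
  have hm : Measurable (fun x : ℝ × ℝ => (d - c) * (x.1 - a)) := by fun_prop
  have := congrArg (fun m => m Set.univ) (map_rect a b c d hc hcd)
  simpa [Measure.map_apply hm MeasurableSet.univ] using this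

/-- enumeration of the cells -/
def idx (i : ℕ) : ℤ × ℕ := (Denumerable.eqv (ℤ × ℕ)).symm i

lemma idx_surj (p : ℤ × ℕ) : ∃ i, idx i = p := (Denumerable.eqv (ℤ × ℕ)).symm.surjective p
lemma idx_inj {i j : ℕ} (h : idx i = idx j) : i = j := (Denumerable.eqv (ℤ × ℕ)).symm.injective h

/-- grid cells -/
def cell (N : ℝ) (i : ℕ) : Set (ℝ × ℝ) :=
  Set.Ioc ((idx i).1 / N) (((idx i).1 + 1) / N) ×ˢ Set.Ioc ((idx i).2 / N) (((idx i).2 + 1) / N)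

lemma mem_cell (N : ℝ) (hN : 0 < N) (i : ℕ) (x : ℝ × ℝ) : x ∈ cell N i ↔
    ((((idx i).1 : ℝ) < N * x.1 ∧ N * x.1 ≤ (idx i).1 + 1) ∧ ((idx i).2 : ℝ) < N * x.2 ∧ N * x.2 ≤ (idx i).2 + 1) := by
  simp only [cell, Set.mem_prod, Set.mem_Ioc, div_lt_iff₀ hN, le_div_iff₀ hN, mul_comm N]

lemma mem_cell' (N : ℝ) (hN : 0 < N) (i : ℕ) (x : ℝ × ℝ) : x ∈ cell N i ↔
    (⌈N * x.1⌉ = (idx i).1 + 1 ∧ ⌈N * x.2⌉ = ((idx i).2 : ℤ) + 1) := by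
  rw [mem_cell N hN, Int.ceil_eq_iff, Int.ceil_eq_iff]
  push_cast
  simp

lemma cell_meas (N : ℝ) (i : ℕ) : MeasurableSet (cell N i) := measurableSet_Ioc.prod measurableSet_Ioc

lemma cell_disj (N : ℝ) (hN : 0 < N) : Pairwise (Function.onFun Disjoint (cell N)) := by
  intro i j hij
  rw [Function.onFun, Set.disjoint_left]
  intro x hx hy
  rw [mem_cell' N hN] at hx hy
  apply hij
  apply idx_inj
  apply Prod.ext
  · have := hx.1.symm.trans hy.1; omega
  · have := hx.2.symm.trans hy.2; omega

lemma exists_cell (N : ℝ) (hN : 0 < N) (x : ℝ × ℝ) (hx : x ∈ UHP) : ∃ i, x ∈ cell N i := by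
  have hx : 0 < x.2 := hx
  have h1 : 0 < ⌈N * x.2⌉ := Int.ceil_pos.2 (by positivity)
  obtain ⟨i, hi⟩ := idx_surj (⌈N * x.1⌉ - 1, (⌈N * x.2⌉ - 1).toNat)
  refine ⟨i, ?_⟩
  rw [mem_cell' N hN, hi]
  constructor
  · simp
  · simp only; omega

lemma ae_UHP : ∀ᵐ x ∂μUH, x ∈ UHP := ae_restrict_mem measurableSet_UHP

lemma ae_cell (N : ℝ) (hN : 0 < N) : ∀ᵐ x ∂μUH, x ∈ ⋃ i, cell N i := by
  filter_upwards [ae_UHP] with x hx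
  exact Set.mem_iUnion.2 (exists_cell N hN x hx)

lemma lintegral_cells (N : ℝ) (hN : 0 < N) (F : ℝ × ℝ → ℝ≥0∞) :
    ∫⁻ x, F x ∂μUH = ∑' i, ∫⁻ x in cell N i, F x ∂μUH := by
  rw [← lintegral_iUnion (cell_meas N) (cell_disj N hN)]
  rw [Measure.restrict_eq_self_of_ae_mem (ae_cell N hN)]

lemma cell_map (N : ℝ) (hN : 0 < N) (i : ℕ) :
    (μUH.restrict (cell N i)).map (fun x => (1 / N) * (x.1 - (idx i).1 / N)) =
      volume.restrict (Set.Ioc 0 (μUH (cell N i)).toReal) := by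
  have h1 : (((idx i).2 : ℝ) + 1) / N - (idx i).2 / N = 1 / N := by ring
  have h0 : (0 : ℝ) ≤ (idx i).2 / N := by positivity
  have hlt : ((idx i).2 : ℝ) / N < ((idx i).2 + 1) / N := by gcongr; linarith
  have hle : ((idx i).1 : ℝ) / N ≤ ((idx i).1 + 1) / N := by gcongr; linarith
  have := map_rect ((idx i).1 / N) (((idx i).1 + 1) / N) ((idx i).2 / N) (((idx i).2 + 1) / N) h0 hlt
  rw [cell, meas_rect _ _ _ _ h0 hle hlt, ENNReal.toReal_ofReal (mul_nonneg (by linarith) (by linarith)), ← this, h1]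

lemma cell_ne_top (N : ℝ) (hN : 0 < N) (i : ℕ) : μUH (cell N i) ≠ ⊤ := by
  have h0 : (0 : ℝ) ≤ (idx i).2 / N := by positivity
  have hlt : ((idx i).2 : ℝ) / N < ((idx i).2 + 1) / N := by gcongr; linarith
  have hle : ((idx i).1 : ℝ) / N ≤ ((idx i).1 + 1) / N := by gcongr; linarith
  rw [cell, meas_rect _ _ _ _ h0 hle hlt]
  exact ENNReal.ofReal_ne_top

/-- the box in which the leftover mass is placed -/
def boxS (n M : ℕ) : Set (ℝ × ℝ) := Set.Ioc (n : ℝ) (n + M) ×ˢ Set.Ioc 0 1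

/-- indices of the cells in the box -/
def boxJ (n M N : ℕ) : Set ℕ := {i | (n * N : ℤ) ≤ (idx i).1 ∧ (idx i).1 + 1 ≤ ((n + M) * N : ℤ) ∧ (idx i).2 + 1 ≤ N}

lemma boxS_meas (n M : ℕ) : MeasurableSet (boxS n M) := measurableSet_Ioc.prod measurableSet_Ioc

lemma mem_boxS_iff (n M N : ℕ) (hN : 0 < N) (i : ℕ) (x : ℝ × ℝ) (hx : x ∈ cell N i) :
    x ∈ boxS n M ↔ i ∈ boxJ n M N := by
  have hN' : (0 : ℝ) < N := by exact_mod_cast hN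
  have hx' := (mem_cell' N hN' i x).1 hx
  have hx2 := ((mem_cell N hN' i x).1 hx).2.1
  have hpos : 0 < x.2 := by
    have : (0 : ℝ) ≤ (idx i).2 := by positivity
    by_contra hc
    push Not at hc
    nlinarith
  have a1 : (n : ℝ) < x.1 ↔ ((n * N : ℤ) : ℝ) < N * x.1 := by
    push_cast
    rw [mul_comm, mul_lt_mul_iff_right₀ hN']
  have a2 : x.1 ≤ n + M ↔ N * x.1 ≤ (((n + M) * N : ℤ) : ℝ) := by
    push_cast
    rw [mul_comm _ (N : ℝ), mul_le_mul_iff_right₀ hN']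
  have a3 : x.2 ≤ 1 ↔ N * x.2 ≤ ((N : ℤ) : ℝ) := by
    push_cast
    nth_rw 2 [← mul_one (N : ℝ)]
    rw [mul_le_mul_iff_right₀ hN']
  simp only [boxS, boxJ, Set.mem_prod, Set.mem_Ioc, Set.mem_ofPred_eq, hpos, true_and, a1, a2, a3,
    ← Int.lt_ceil, ← Int.ceil_le, hx'.1, hx'.2]
  omega

lemma box_union (n M N : ℕ) (hN : 0 < N) : (⋃ i ∈ boxJ n M N, cell N i) = boxS n M := by
  have hN' : (0 : ℝ) < N := by exact_mod_cast hN
  ext x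
  simp only [Set.mem_iUnion, exists_prop]
  constructor
  · rintro ⟨i, hi, hx⟩
    exact (mem_boxS_iff n M N hN i x hx).2 hi
  · intro hx
    obtain ⟨i, hi⟩ := exists_cell N hN' x (show 0 < x.2 from hx.2.1)
    exact ⟨i, (mem_boxS_iff n M N hN i x hi).1 hx, hi⟩

lemma box_map (n M : ℕ) : (μUH.restrict (boxS n M)).map (fun x => ((1 : ℝ) - 0) * (x.1 - n)) =
      volume.restrict (Set.Ioc 0 (M : ℝ)) := by
  have := map_rect n (n + M) 0 1 le_rfl one_pos
  rw [boxS, this]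
  congr 2; ring

open Classical in
/-- weights -/
def wt (n M : ℕ) (x : ℝ × ℝ) : ℝ :=
  if x ∈ boxS n M then 0 else ((⌈((n + 1 : ℕ) : ℝ) * x.2⌉ : ℝ) - 1) / (⌈((n + 1 : ℕ) : ℝ) * x.2⌉ : ℝ)

lemma wt_meas (n M : ℕ) : Measurable (wt n M) := by
  unfold wt
  apply Measurable.ite (boxS_meas n M) measurable_const
  have : Measurable (fun x : ℝ × ℝ => (⌈((n + 1 : ℕ) : ℝ) * x.2⌉ : ℝ)) := by
    apply Measurable.comp (g := fun z : ℤ => (z : ℝ)) (measurable_from_top)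
    exact Int.measurable_ceil.comp (measurable_snd.const_mul _)
  exact (this.sub_const 1).div this

lemma wt_nonneg (n M : ℕ) (x : ℝ × ℝ) (hx : x ∈ UHP) : 0 ≤ wt n M x := by
  have hx : 0 < x.2 := hx
  have h1 : 0 < ⌈((n + 1 : ℕ) : ℝ) * x.2⌉ := Int.ceil_pos.2 (by positivity)
  have h2 : (1 : ℝ) ≤ (⌈((n + 1 : ℕ) : ℝ) * x.2⌉ : ℝ) := by exact_mod_cast h1
  unfold wt
  split_ifs
  · exact le_rfl
  · exact div_nonneg (by linarith) (by linarith)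

lemma wt_le_one (n M : ℕ) (x : ℝ × ℝ) (hx : x ∈ UHP) : wt n M x ≤ 1 := by
  have hx : 0 < x.2 := hx
  have h1 : 0 < ⌈((n + 1 : ℕ) : ℝ) * x.2⌉ := Int.ceil_pos.2 (by positivity)
  have h2 : (1 : ℝ) ≤ (⌈((n + 1 : ℕ) : ℝ) * x.2⌉ : ℝ) := by exact_mod_cast h1
  unfold wt
  split_ifs
  · exact zero_le_one
  · rw [div_le_one (by linarith)]; linarith

lemma wt_tendsto (M : ℕ) (x : ℝ × ℝ) (hx : x ∈ UHP) : Tendsto (fun n => wt n M x) atTop (𝓝 1) := by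
  have hx : 0 < x.2 := hx
  have h1 : Tendsto (fun n : ℕ => (⌈((n + 1 : ℕ) : ℝ) * x.2⌉ : ℝ)) atTop atTop := by
    refine tendsto_atTop_mono (f := fun n : ℕ => ((n + 1 : ℕ) : ℝ) * x.2) (fun n => Int.le_ceil _) ?_
    apply Tendsto.atTop_mul_const hx
    exact tendsto_natCast_atTop_atTop.comp (tendsto_add_atTop_nat 1)
  have h2 : Tendsto (fun n : ℕ => 1 - (⌈((n + 1 : ℕ) : ℝ) * x.2⌉ : ℝ)⁻¹) atTop (𝓝 (1 - 0)) :=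
    tendsto_const_nhds.sub h1.inv_tendsto_atTop
  rw [sub_zero] at h2
  refine h2.congr' ?_
  obtain ⟨m, hm⟩ := exists_nat_ge x.1
  filter_upwards [eventually_ge_atTop m] with n hn
  have h3 : x ∉ boxS n M := by
    intro hb
    have := hb.1.1
    have h4 : (m : ℝ) ≤ n := by exact_mod_cast hn
    linarith
  have h1 : 0 < ⌈((n + 1 : ℕ) : ℝ) * x.2⌉ := Int.ceil_pos.2 (by positivity)
  have h2 : (⌈((n + 1 : ℕ) : ℝ) * x.2⌉ : ℝ) ≠ 0 := by exact_mod_cast h1.ne'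
  rw [wt, if_neg h3]
  field_simp

lemma wt_box (n M i : ℕ) (hi : i ∈ boxJ n M (n + 1)) (x : ℝ × ℝ) (hx : x ∈ cell ((n + 1 : ℕ) : ℝ) i) :
    wt n M x = 0 := by
  rw [wt, if_pos ((mem_boxS_iff n M (n+1) (Nat.succ_pos n) i x hx).2 hi)]

lemma wt_notbox (n M i : ℕ) (hi : i ∉ boxJ n M (n + 1)) (x : ℝ × ℝ) (hx : x ∈ cell ((n + 1 : ℕ) : ℝ) i) :
    wt n M x = (idx i).2 / ((idx i).2 + 1) := by
  rw [wt, if_neg (fun h => hi ((mem_boxS_iff n M (n+1) (Nat.succ_pos n) i x hx).1 h))]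
  rw [((mem_cell' _ (by positivity) i x).1 hx).2]
  push_cast
  ring

lemma impulse_bound (i₀ : ℝ) (hi₀ : 0 < i₀) (ζ : ℝ × ℝ → ℝ) (hnn : ∀ x, 0 ≤ ζ x) (hint : Integrable ζ μUH)
    (himp : impulse ζ ≤ i₀) (n M : ℕ) (η : ℝ × ℝ → ℝ≥0) (hηm : Measurable η)
    (hη : ∀ i, ∫⁻ x in cell ((n + 1 : ℕ) : ℝ) i, (η x : ℝ≥0∞) ∂μUH =
      ∫⁻ x in cell ((n + 1 : ℕ) : ℝ) i, ENNReal.ofReal (wt n M x * ζ x) ∂μUH) :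
    impulse (fun x => (η x : ℝ)) ≤ i₀ := by
  set N : ℝ := ((n + 1 : ℕ) : ℝ) with hN
  have hNpos : 0 < N := by positivity
  have hN1 : 1 ≤ N := by rw [hN]; push_cast; linarith [(Nat.cast_nonneg n : (0 : ℝ) ≤ n)]
  have hζm : AEMeasurable ζ μUH := hint.aestronglyMeasurable.aemeasurable
  -- lower and upper bounds on cells
  have hlow : ∀ (i : ℕ) (g : ℝ × ℝ → ℝ≥0∞), ENNReal.ofReal ((idx i).2 / N) * ∫⁻ x in cell N i, g x ∂μUH ≤
      ∫⁻ x in cell N i, g x * ENNReal.ofReal x.2 ∂μUH := by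
    intro i g
    rw [← lintegral_const_mul' _ _ ENNReal.ofReal_ne_top]
    apply setLIntegral_mono' (cell_meas N i)
    intro x hx
    rw [mul_comm]
    gcongr
    exact hx.2.1.le
  have hup : ∀ (i : ℕ) (g : ℝ × ℝ → ℝ≥0∞), ∫⁻ x in cell N i, g x * ENNReal.ofReal x.2 ∂μUH ≤
      ENNReal.ofReal (((idx i).2 + 1) / N) * ∫⁻ x in cell N i, g x ∂μUH := by
    intro i g
    rw [← lintegral_const_mul' _ _ ENNReal.ofReal_ne_top]
    apply setLIntegral_mono' (cell_meas N i)
    intro x hx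
    rw [mul_comm]
    gcongr
    exact hx.2.2
  set Z : ℕ → ℝ≥0∞ := fun i => ∫⁻ x in cell N i, ENNReal.ofReal (ζ x) ∂μUH with hZ
  have hηJ : ∀ i ∈ boxJ n M (n + 1), ∫⁻ x in cell N i, (η x : ℝ≥0∞) ∂μUH = 0 := by
    intro i hi
    rw [hη, setLIntegral_congr_fun (g := fun _ => 0) (cell_meas N i)]
    · simp
    · intro x hx; simp [wt_box n M i hi x hx]
  have hηJ' : ∀ i ∉ boxJ n M (n + 1), ∫⁻ x in cell N i, (η x : ℝ≥0∞) ∂μUH =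
      ENNReal.ofReal ((idx i).2 / ((idx i).2 + 1)) * Z i := by
    intro i hi
    rw [hη, hZ, ← lintegral_const_mul' _ _ ENNReal.ofReal_ne_top]
    apply setLIntegral_congr_fun (cell_meas N i)
    intro x hx
    simp only
    rw [wt_notbox n M i hi x hx, ENNReal.ofReal_mul (by positivity)]
  have hA : ∫⁻ x, (η x : ℝ≥0∞) * ENNReal.ofReal x.2 ∂μUH ≤ ∫⁻ x, ENNReal.ofReal (ζ x) * ENNReal.ofReal x.2 ∂μUH := by
    rw [lintegral_cells N hNpos, lintegral_cells N hNpos (fun x => ENNReal.ofReal (ζ x) * ENNReal.ofReal x.2)]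
    apply ENNReal.tsum_le_tsum
    intro i
    refine (hup i _).trans ?_
    by_cases hi : i ∈ boxJ n M (n + 1)
    · rw [hηJ i hi]; simp
    · refine le_trans (le_of_eq ?_) (hlow i _)
      rw [hηJ' i hi, ← mul_assoc, ← ENNReal.ofReal_mul (by positivity)]
      congr 2
      field_simp
  have hB : ∫⁻ x, ENNReal.ofReal (ζ x) * ENNReal.ofReal x.2 ∂μUH ≤
      4 * ∫⁻ x, (η x : ℝ≥0∞) * ENNReal.ofReal x.2 ∂μUH + ∫⁻ x, ENNReal.ofReal (ζ x) ∂μUH := by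
    rw [lintegral_cells N hNpos, lintegral_cells N hNpos (fun x => (η x : ℝ≥0∞) * ENNReal.ofReal x.2),
      lintegral_cells N hNpos (fun x => ENNReal.ofReal (ζ x)), ← ENNReal.tsum_mul_left, ← ENNReal.tsum_add]
    apply ENNReal.tsum_le_tsum
    intro i
    have small : ((idx i).2 : ℝ) + 1 ≤ N → ∫⁻ x in cell N i, ENNReal.ofReal (ζ x) * ENNReal.ofReal x.2 ∂μUH ≤
        4 * (∫⁻ x in cell N i, (η x : ℝ≥0∞) * ENNReal.ofReal x.2 ∂μUH) + ∫⁻ x in cell N i, ENNReal.ofReal (ζ x) ∂μUH := by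
      intro h
      refine (hup i _).trans (le_trans ?_ le_add_self)
      have : ENNReal.ofReal (((idx i).2 + 1) / N) ≤ 1 := by
        rw [← ENNReal.ofReal_one]
        apply ENNReal.ofReal_le_ofReal
        rw [div_le_one hNpos]; exact h
      exact mul_le_of_le_one_left' this
    by_cases hi : i ∈ boxJ n M (n + 1)
    · apply small
      rw [hN]
      exact_mod_cast hi.2.2
    · rcases Nat.eq_zero_or_pos (idx i).2 with hk | hk
      · apply small
        rw [hk]; simpa using hN1
      · have hk' : (1 : ℝ) ≤ (idx i).2 := by exact_mod_cast hk
        refine (hup i _).trans (le_trans ?_ le_self_add)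
        refine le_trans ?_ (mul_le_mul_right (hlow i _) 4)
        rw [hηJ' i hi, ← mul_assoc, ← mul_assoc]
        gcongr
        have h4 : (4 : ℝ≥0∞) = ENNReal.ofReal 4 := by simp
        rw [h4, ← ENNReal.ofReal_mul (by norm_num), ← ENNReal.ofReal_mul (by positivity)]
        apply ENNReal.ofReal_le_ofReal
        rw [div_le_iff₀ hNpos]
        have : 4 * (((idx i).2 : ℝ) / N) * ((idx i).2 / ((idx i).2 + 1)) * N = 4 * ((idx i).2 : ℝ) ^ 2 / ((idx i).2 + 1) := by
          field_simp
        rw [this, le_div_iff₀ (by positivity)]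
        nlinarith
  have hηe : ∫⁻ x, ENNReal.ofReal ((η x : ℝ) * x.2) ∂μUH = ∫⁻ x, (η x : ℝ≥0∞) * ENNReal.ofReal x.2 ∂μUH := by
    congr 1; ext x
    rw [ENNReal.ofReal_mul (by positivity)]; simp
  have hζe : ∫⁻ x, ENNReal.ofReal (ζ x * x.2) ∂μUH = ∫⁻ x, ENNReal.ofReal (ζ x) * ENNReal.ofReal x.2 ∂μUH := by
    congr 1; ext x
    rw [ENNReal.ofReal_mul (hnn x)]
  have hη0 : 0 ≤ᵐ[μUH] fun x => (η x : ℝ) * x.2 := by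
    filter_upwards [ae_UHP] with x hx
    exact mul_nonneg (by positivity) (le_of_lt hx)
  have hζ0 : 0 ≤ᵐ[μUH] fun x => ζ x * x.2 := by
    filter_upwards [ae_UHP] with x hx
    exact mul_nonneg (hnn x) (le_of_lt hx)
  have hηmm : AEStronglyMeasurable (fun x => (η x : ℝ) * x.2) μUH :=
    (hηm.coe_nnreal_real.mul measurable_snd).aestronglyMeasurable
  have hζmm : AEStronglyMeasurable (fun x => ζ x * x.2) μUH :=
    (hζm.mul measurable_snd.aemeasurable).aestronglyMeasurable
  by_cases hfin : ∫⁻ x, ENNReal.ofReal (ζ x) * ENNReal.ofReal x.2 ∂μUH = ⊤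
  · have : ¬ Integrable (fun x => (η x : ℝ) * x.2) μUH := by
      intro hI
      have h1 := (hasFiniteIntegral_iff_ofReal hη0).1 hI.2
      rw [hηe] at h1
      have h2 := (hasFiniteIntegral_iff_ofReal (Eventually.of_forall hnn)).1 hint.2
      rw [hfin, top_le_iff] at hB
      exact ENNReal.add_ne_top.2 ⟨ENNReal.mul_ne_top (by simp) h1.ne, h2.ne⟩ hB
    rw [impulse, integral_undef this]
    exact hi₀.le
  · refine le_trans ?_ himp
    rw [impulse, impulse, integral_eq_lintegral_of_nonneg_ae hη0 hηmm, integral_eq_lintegral_of_nonneg_ae hζ0 hζmm, hηe, hζe]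
    exact ENNReal.toReal_mono hfin hA

lemma stage (ζ₀ : ℝ × ℝ → ℝ) (h : ℝ → ℝ≥0) (M' : ℝ) (M : ℕ)
    (hD : ∀ (a : ℝ≥0) (t : ℝ),
      a < h t ↔ (0 < t ∧ ENNReal.ofReal t < μUH {x | (a : ℝ) < ζ₀ x}))
    (h0M : μUH {x | 0 < ζ₀ x} ≤ ENNReal.ofReal M)
    (i₀ : ℝ) (hi₀ : 0 < i₀) (ζ : ℝ × ℝ → ℝ) (hnn : ∀ x, 0 ≤ ζ x) (hint : Integrable ζ μUH)
    (himp : impulse ζ ≤ i₀)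
    (hI : CutInv μUH (fun x => ENNReal.ofReal (ζ x)) M' Set.univ h) (n : ℕ) :
    ∃ η : ℝ × ℝ → ℝ≥0, Measurable η ∧ memRplus ζ₀ (fun x => (η x : ℝ)) ∧ impulse (fun x => (η x : ℝ)) ≤ i₀ ∧
      (∀ i, ∫⁻ x in cell ((n + 1 : ℕ) : ℝ) i, (η x : ℝ≥0∞) ∂μUH =
      ∫⁻ x in cell ((n + 1 : ℕ) : ℝ) i, ENNReal.ofReal (wt n M x * ζ x) ∂μUH) ∧
      (∀ a : ℝ, 0 < a → μUH {x | a < (η x : ℝ)} ≤ μUH {x | a < ζ₀ x}) := by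
  have hNpos : (0 : ℝ) < ((n + 1 : ℕ) : ℝ) := by positivity
  have hI' : CutInv μUH (fun x => ENNReal.ofReal (wt n M x * ζ x)) M' Set.univ h := by
    refine ⟨hI.meas, hI.fin, hI.neg, hI.big, ?_⟩
    intro E h1 h2 h3
    refine le_trans ?_ (hI.dom E h1 h2 h3)
    apply lintegral_mono_ae
    filter_upwards [ae_restrict_of_ae ae_UHP] with x hx
    apply ENNReal.ofReal_le_ofReal
    exact mul_le_of_le_one_left (hnn x) (wt_le_one n M x hx)
  obtain ⟨η, h1, h2, h3, h4⟩ := build ζ₀ (fun x => ENNReal.ofReal (wt n M x * ζ x)) h M M' hD h0M hI' (cell ((n + 1 : ℕ) : ℝ)) (cell_meas _)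
    (cell_disj _ hNpos) (cell_ne_top _ hNpos) (ae_cell _ hNpos) _ (fun i => by fun_prop) (cell_map _ hNpos)
    (boxJ n M (n + 1)) (by
      intro i hi
      rw [setLIntegral_congr_fun (g := fun _ => 0) (cell_meas _ i)]
      · simp
      · intro x hx; simp [wt_box n M i hi x hx])
    (fun x => ((1 : ℝ) - 0) * (x.1 - n)) (by fun_prop)
    (by rw [box_union n M (n + 1) (Nat.succ_pos n)]; exact box_map n M)
  exact ⟨η, h1, h2, impulse_bound i₀ hi₀ ζ hnn hint himp n M η h1 h3, h3, h4⟩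

lemma inner_rpow (p : ℝ) (hp : 1 < p) (t : ℝ) (ht : 0 ≤ t) :
    ∫⁻ a in Set.Ioi (0:ℝ), ENNReal.ofReal (t - a) * ENNReal.ofReal (a ^ (p - 2)) =
      ENNReal.ofReal (1 / (p - 1) - 1 / p) * ENNReal.ofReal (t ^ p) := by
  have e1 : ∫⁻ a in Set.Ioi (0:ℝ), ENNReal.ofReal (t - a) * ENNReal.ofReal (a ^ (p - 2)) =
      ∫⁻ a in Set.Ioc (0:ℝ) t, ENNReal.ofReal (t * a ^ (p - 2) - a ^ (p - 1)) := by
    rw [← lintegral_indicator measurableSet_Ioi, ← lintegral_indicator measurableSet_Ioc]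
    congr 1; ext a
    by_cases h0 : 0 < a
    · by_cases h1 : a ≤ t
      · rw [Set.indicator_of_mem (show a ∈ Set.Ioi (0:ℝ) from h0), Set.indicator_of_mem (show a ∈ Set.Ioc (0:ℝ) t from ⟨h0, h1⟩),
          ← ENNReal.ofReal_mul (by linarith)]
        congr 1
        have : a ^ (p - 1) = a * a ^ (p - 2) := by
          rw [show p - 1 = 1 + (p - 2) by ring, rpow_add h0, rpow_one]
        rw [this]; ring
      · rw [Set.indicator_of_mem (show a ∈ Set.Ioi (0:ℝ) from h0), Set.indicator_of_notMem (fun h => h1 h.2),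
          ENNReal.ofReal_of_nonpos (by linarith), zero_mul]
    · rw [Set.indicator_of_notMem (show a ∉ Set.Ioi (0:ℝ) from h0), Set.indicator_of_notMem (fun h => h0 h.1)]
  have i1 : IntervalIntegrable (fun a : ℝ => a ^ (p - 2)) volume 0 t :=
    intervalIntegral.intervalIntegrable_rpow' (by linarith)
  have i2 : IntervalIntegrable (fun a : ℝ => a ^ (p - 1)) volume 0 t :=
    intervalIntegral.intervalIntegrable_rpow' (by linarith)
  have i3 := (i1.const_mul t).sub i2
  rw [e1, ← ofReal_integral_eq_lintegral_ofReal, ← intervalIntegral.integral_of_le ht,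
    intervalIntegral.integral_sub (i1.const_mul t) i2, intervalIntegral.integral_const_mul,
    integral_rpow (Or.inl (by linarith)), integral_rpow (Or.inl (by linarith)), ← ENNReal.ofReal_mul]
  · congr 1
    rw [zero_rpow (by linarith), zero_rpow (by linarith)]
    rcases ht.eq_or_lt with h | h
    · rw [← h, zero_rpow (show p - 1 + 1 ≠ 0 by linarith), zero_rpow (show p ≠ 0 by linarith)]; simp
    · have : t ^ p = t * t ^ (p - 2 + 1) := by
        rw [show p = 1 + (p - 2 + 1) by ring, rpow_add h, rpow_one]; ring_nf
      rw [show p - 1 + 1 = p by ring, this, show p - 2 + 1 = p - 1 by ring]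
      ring
  · rw [sub_nonneg]; exact one_div_le_one_div_of_le (by linarith) (by linarith)
  · exact (intervalIntegrable_iff_integrableOn_Ioc_of_le ht).1 i3
  · refine (ae_restrict_iff' measurableSet_Ioc).2 (ae_of_all _ fun a ha => ?_)
    have : a ^ (p - 1) = a * a ^ (p - 2) := by
      rw [show p - 1 = 1 + (p - 2) by ring, rpow_add ha.1, rpow_one]
    simp only [Pi.zero_apply]
    rw [this, ← sub_mul]
    exact mul_nonneg (by linarith [ha.2]) (rpow_nonneg ha.1.le _)

lemma prec_lint (ζ₀ ζ : ℝ × ℝ → ℝ) (h0i : Integrable ζ₀ μUH)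
    (hi : Integrable ζ μUH) (hprec : prec ζ ζ₀) (a : ℝ) (hapos : 0 < a) :
    ∫⁻ x, ENNReal.ofReal (ζ x - a) ∂μUH ≤ ∫⁻ x, ENNReal.ofReal (ζ₀ x - a) ∂μUH := by
    have e1 : ∀ (y : ℝ), ENNReal.ofReal (y - a) = ENNReal.ofReal (max (y - a) 0) := by
      intro y; rw [ENNReal.ofReal_max]; simp
    have hint : ∀ f : ℝ × ℝ → ℝ, Integrable f μUH → Integrable (fun x => max (f x - a) 0) μUH := by
      intro f hf
      refine Integrable.mono hf ?_ ?_
      · exact ((hf.aestronglyMeasurable.aemeasurable.sub_const _).max aemeasurable_const).aestronglyMeasurable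
      · refine Eventually.of_forall fun x => ?_
        rw [Real.norm_of_nonneg (le_max_right _ _), Real.norm_eq_abs]
        apply max_le _ (abs_nonneg _)
        linarith [le_abs_self (f x)]
    simp_rw [e1]
    rw [← ofReal_integral_eq_lintegral_ofReal (hint _ hi) (Eventually.of_forall fun x => le_max_right _ _),
      ← ofReal_integral_eq_lintegral_ofReal (hint _ h0i) (Eventually.of_forall fun x => le_max_right _ _)]
    exact ENNReal.ofReal_le_ofReal (hprec a hapos)

lemma lp_of_prec (p : ℝ) (hp : 1 < p) (ζ₀ ζ : ℝ × ℝ → ℝ) (h0i : Integrable ζ₀ μUH)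
    (h0nn : ∀ x, 0 ≤ ζ₀ x) (h0mem : MemLp ζ₀ (ENNReal.ofReal p) μUH)
    (hnn : ∀ x, 0 ≤ ζ x) (hi : Integrable ζ μUH) (hprec : prec ζ ζ₀) :
    MemLp ζ (ENNReal.ofReal p) μUH := by
  have : SFinite μUH := by unfold μUH; infer_instance
  have key : ∀ f : ℝ × ℝ → ℝ, AEMeasurable f μUH → (∀ x, 0 ≤ f x) →
      ∫⁻ a in Set.Ioi (0:ℝ), (∫⁻ x, ENNReal.ofReal (f x - a) ∂μUH) * ENNReal.ofReal (a ^ (p - 2)) =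
      ENNReal.ofReal (1 / (p - 1) - 1 / p) * ∫⁻ x, ENNReal.ofReal (f x ^ p) ∂μUH := by
    intro f hf hfn
    rw [← lintegral_const_mul' _ _ ENNReal.ofReal_ne_top]
    simp_rw [← fun x => inner_rpow p hp (f x) (hfn x)]
    rw [lintegral_lintegral_swap]
    · refine lintegral_congr fun a => ?_
      rw [lintegral_mul_const' _ _ ENNReal.ofReal_ne_top]
    · have h1 : AEMeasurable (fun z : (ℝ × ℝ) × ℝ => f z.1) (μUH.prod (volume.restrict (Set.Ioi (0:ℝ)))) :=
        hf.comp_fst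
      exact ((h1.sub measurable_snd.aemeasurable).ennreal_ofReal).mul
        ((measurable_snd.pow_const (p-2)).ennreal_ofReal.aemeasurable)
  have hc : 0 < 1 / (p - 1) - 1 / p := by
    rw [sub_pos]; exact one_div_lt_one_div_of_lt (by linarith) (by linarith)
  have hle : ENNReal.ofReal (1 / (p - 1) - 1 / p) * ∫⁻ x, ENNReal.ofReal (ζ x ^ p) ∂μUH ≤
     ENNReal.ofReal (1 / (p - 1) - 1 / p) * ∫⁻ x, ENNReal.ofReal (ζ₀ x ^ p) ∂μUH := by
    rw [← key ζ hi.1.aemeasurable hnn, ← key ζ₀ h0i.1.aemeasurable h0nn]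
    refine setLIntegral_mono' measurableSet_Ioi fun a ha => ?_
    exact mul_le_mul_left (prec_lint ζ₀ ζ h0i hi hprec a ha) _
  have hp0 : ENNReal.ofReal p ≠ 0 := by simp; linarith
  have e : ∀ f : ℝ × ℝ → ℝ, (∀ x, 0 ≤ f x) → ∫⁻ x, ‖f x‖ₑ ^ p ∂μUH = ∫⁻ x, ENNReal.ofReal (f x ^ p) ∂μUH := by
    intro f hf
    refine lintegral_congr fun x => ?_
    rw [Real.enorm_eq_ofReal (hf x), ENNReal.ofReal_rpow_of_nonneg (hf x) (by linarith)]
  refine ⟨hi.1, ?_⟩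
  have h2 := (eLpNorm_lt_top_iff_lintegral_rpow_enorm_lt_top hp0 ENNReal.ofReal_ne_top).1 h0mem.2
  rw [eLpNorm_lt_top_iff_lintegral_rpow_enorm_lt_top hp0 ENNReal.ofReal_ne_top]
  rw [ENNReal.toReal_ofReal (by linarith)] at h2 ⊢
  rw [e ζ₀ h0nn] at h2
  rw [e ζ hnn]
  refine lt_of_le_of_lt ?_ h2
  exact (ENNReal.mul_le_mul_iff_right (by simpa using hc) ENNReal.ofReal_ne_top).1 hle

lemma lp_of_dist (p : ℝ) (hp : 1 < p) (ζ₀ η : ℝ × ℝ → ℝ)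
    (h0nn : ∀ x, 0 ≤ ζ₀ x) (h0m : AEMeasurable ζ₀ μUH)
    (hnn : ∀ x, 0 ≤ η x) (hm : AEMeasurable η μUH)
    (hd : ∀ a > 0, μUH {x | a < η x} ≤ μUH {x | a < ζ₀ x}) :
    eLpNorm η (ENNReal.ofReal p) μUH ≤ eLpNorm ζ₀ (ENNReal.ofReal p) μUH := by
  have hp0 : ENNReal.ofReal p ≠ 0 := by simp; linarith
  have e : ∀ f : ℝ × ℝ → ℝ, (∀ x, 0 ≤ f x) → ∫⁻ x, ‖f x‖ₑ ^ p ∂μUH = ∫⁻ x, ENNReal.ofReal (f x ^ p) ∂μUH := by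
    intro f hf
    refine lintegral_congr fun x => ?_
    rw [Real.enorm_eq_ofReal (hf x), ENNReal.ofReal_rpow_of_nonneg (hf x) (by linarith)]
  rw [eLpNorm_eq_lintegral_rpow_enorm_toReal hp0 ENNReal.ofReal_ne_top,
    eLpNorm_eq_lintegral_rpow_enorm_toReal hp0 ENNReal.ofReal_ne_top,
    ENNReal.toReal_ofReal (by linarith), e _ hnn, e _ h0nn,
    lintegral_rpow_eq_lintegral_meas_lt_mul μUH (ae_of_all _ hnn) hm (by linarith),
    lintegral_rpow_eq_lintegral_meas_lt_mul μUH (ae_of_all _ h0nn) h0m (by linarith)]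
  refine ENNReal.rpow_le_rpow (mul_le_mul_right ?_ _) (by positivity)
  refine setLIntegral_mono' measurableSet_Ioi fun a ha => ?_
  exact mul_le_mul_left (hd a ha) _

lemma pair_eq (N : ℝ) (hN : 0 < N) (η f ψ : ℝ × ℝ → ℝ)
    (h : ∀ i, ∫ x in cell N i, η x ∂μUH = ∫ x in cell N i, f x ∂μUH)
    (h1 : Integrable (fun x => η x * ψ x) μUH) (h2 : Integrable (fun x => f x * ψ x) μUH)
    (hc : ∀ i, ∃ c, ∀ x ∈ cell N i, ψ x = c) :
    ∫ x, η x * ψ x ∂μUH = ∫ x, f x * ψ x ∂μUH := by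
  have hr : μUH.restrict (⋃ i, cell N i) = μUH := Measure.restrict_eq_self_of_ae_mem (ae_cell N hN)
  have e : ∀ F : ℝ × ℝ → ℝ, Integrable F μUH → ∫ x, F x ∂μUH = ∑' i, ∫ x in cell N i, F x ∂μUH := by
    intro F hF
    rw [← integral_iUnion (cell_meas N) (cell_disj N hN) hF.integrableOn, hr]
  rw [e _ h1, e _ h2]
  congr 1; ext i
  obtain ⟨c, hc⟩ := hc i
  have k : ∀ g : ℝ × ℝ → ℝ, ∫ x in cell N i, g x * ψ x ∂μUH = (∫ x in cell N i, g x ∂μUH) * c := by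
    intro g
    rw [← integral_mul_const]
    exact setIntegral_congr_fun (cell_meas N i) fun x hx => by simp only [hc x hx]
  rw [k, k, h]

/-- round to the upper right corner of the cell -/
def rnd (N : ℝ) (x : ℝ × ℝ) : ℝ × ℝ := (⌈N * x.1⌉ / N, ⌈N * x.2⌉ / N)

lemma rnd_meas (N : ℝ) : Measurable (rnd N) := by
  have hc : Measurable (fun z : ℤ => (z : ℝ)) := measurable_from_top
  exact ((hc.comp (Int.measurable_ceil.comp (measurable_fst.const_mul _))).div_const _).prodMk
    ((hc.comp (Int.measurable_ceil.comp (measurable_snd.const_mul _))).div_const _)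

lemma rnd_dist (N : ℝ) (hN : 0 < N) (x : ℝ × ℝ) : dist (rnd N x) x ≤ 1 / N := by
  have k : ∀ y : ℝ, dist ((⌈N * y⌉ : ℝ) / N) y ≤ 1 / N := by
    intro y
    have h1 := Int.le_ceil (N * y)
    have h2 := (Int.ceil_lt_add_one (N * y)).le
    rw [Real.dist_eq, show (⌈N * y⌉ : ℝ) / N - y = (⌈N * y⌉ - N * y) / N by field_simp, abs_div, abs_of_pos hN,
      abs_of_nonneg (by linarith)]
    gcongr
    linarith
  rw [Prod.dist_eq]
  exact max_le (k _) (k _)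

lemma conv_test (M : ℕ) (ζ : ℝ × ℝ → ℝ) (hnn : ∀ x, 0 ≤ ζ x) (hint : Integrable ζ μUH)
    (η : ℕ → ℝ × ℝ → ℝ≥0) (hm : ∀ n, Measurable (η n))
    (hη : ∀ n i, ∫⁻ x in cell ((n+1:ℕ):ℝ) i, (η n x:ℝ≥0∞) ∂μUH =
      ∫⁻ x in cell ((n+1:ℕ):ℝ) i, ENNReal.ofReal (wt n M x * ζ x) ∂μUH)
    (φ : ℝ × ℝ → ℝ) (hφ : Continuous φ) (hs : HasCompactSupport φ) :
    (∀ n, Integrable (fun x => (η n x : ℝ)) μUH) ∧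
    Tendsto (fun n => ∫ x, (η n x : ℝ) * φ x ∂μUH) atTop (𝓝 (∫ x, ζ x * φ x ∂μUH)) := by
  have hN : ∀ n : ℕ, (0:ℝ) < ((n+1:ℕ):ℝ) := fun n => by positivity
  have hwz : ∀ n, ∀ᵐ x ∂μUH, 0 ≤ wt n M x * ζ x ∧ wt n M x * ζ x ≤ ζ x := by
    intro n
    filter_upwards [ae_UHP] with x hx
    exact ⟨mul_nonneg (wt_nonneg n M x hx) (hnn x), mul_le_of_le_one_left (hnn x) (wt_le_one n M x hx)⟩
  have hwm : ∀ n, AEStronglyMeasurable (fun x => wt n M x * ζ x) μUH := fun n =>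
    (wt_meas n M).aestronglyMeasurable.mul hint.1
  have hwi : ∀ n, Integrable (fun x => wt n M x * ζ x) μUH := by
    intro n
    refine hint.mono (hwm n) ?_
    filter_upwards [hwz n] with x hx
    rw [Real.norm_of_nonneg hx.1, Real.norm_of_nonneg (hnn x)]; exact hx.2
  have htot : ∀ n, ∫⁻ x, (η n x:ℝ≥0∞) ∂μUH = ∫⁻ x, ENNReal.ofReal (wt n M x * ζ x) ∂μUH := by
    intro n
    rw [lintegral_cells _ (hN n), lintegral_cells _ (hN n)]
    simp_rw [hη n]
  have hlt : ∀ n, ∫⁻ x, (η n x:ℝ≥0∞) ∂μUH < ⊤ := by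
    intro n
    rw [htot, ← ofReal_integral_eq_lintegral_ofReal (hwi n) ((hwz n).mono fun x hx => hx.1)]
    exact ENNReal.ofReal_lt_top
  have hηi : ∀ n, Integrable (fun x => (η n x : ℝ)) μUH := by
    intro n
    refine ⟨(hm n).coe_nnreal_real.aestronglyMeasurable, ?_⟩
    rw [hasFiniteIntegral_iff_enorm]
    convert hlt n using 3 with x
    simp
  have hcon : ∀ n, ∀ s, ∫ x in s, (η n x : ℝ) ∂μUH = (∫⁻ x in s, (η n x : ℝ≥0∞) ∂μUH).toReal := by
    intro n s
    rw [integral_eq_lintegral_of_nonneg_ae (ae_of_all _ fun x => NNReal.coe_nonneg (η n x)) (hηi n).1.restrict]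
    simp
  have hcell : ∀ n i, ∫ x in cell ((n+1:ℕ):ℝ) i, (η n x : ℝ) ∂μUH = ∫ x in cell ((n+1:ℕ):ℝ) i, wt n M x * ζ x ∂μUH := by
    intro n i
    rw [hcon, hη, integral_eq_lintegral_of_nonneg_ae (ae_restrict_of_ae ((hwz n).mono fun x hx => hx.1)) (hwm n).restrict]
  have hmass : ∀ n, ∫ x, (η n x : ℝ) ∂μUH ≤ ∫ x, ζ x ∂μUH := by
    intro n
    have := hcon n Set.univ
    simp only [Measure.restrict_univ] at this
    rw [this, htot, ← integral_eq_lintegral_of_nonneg_ae ((hwz n).mono fun x hx => hx.1) (hwm n)]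
    exact integral_mono_ae (hwi n) hint ((hwz n).mono fun x hx => hx.2)
  refine ⟨hηi, ?_⟩
  obtain ⟨B, hB⟩ := hφ.bounded_above_of_compact_support hs
  set ψ : ℕ → ℝ × ℝ → ℝ := fun n x => φ (rnd ((n+1:ℕ):ℝ) x) with hψ
  have hψm : ∀ n, Measurable (ψ n) := fun n => hφ.measurable.comp (rnd_meas _)
  have hr : ∀ x, Tendsto (fun n : ℕ => rnd ((n+1:ℕ):ℝ) x) atTop (𝓝 x) := by
    intro x
    rw [tendsto_iff_dist_tendsto_zero]
    refine squeeze_zero (fun _ => dist_nonneg) (fun n => rnd_dist _ (hN n) x) ?_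
    have := tendsto_one_div_add_atTop_nhds_zero_nat (𝕜 := ℝ)
    simpa using this
  have A : Tendsto (fun n => ∫ x, wt n M x * ζ x * ψ n x ∂μUH) atTop (𝓝 (∫ x, ζ x * φ x ∂μUH)) := by
    refine tendsto_integral_of_dominated_convergence (fun x => ζ x * B) (fun n => (hwm n).mul (hψm n).aestronglyMeasurable)
      (hint.mul_const B) ?_ ?_
    · intro n
      filter_upwards [hwz n] with x hx
      rw [norm_mul, Real.norm_of_nonneg hx.1]
      exact mul_le_mul hx.2 (hB _) (norm_nonneg _) (hnn x)
    · filter_upwards [ae_UHP] with x hx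
      have := ((wt_tendsto M x hx).mul_const (ζ x)).mul ((hφ.tendsto x).comp (hr x))
      simpa [hψ] using this
  have E : ∀ n, ∫ x, (η n x : ℝ) * ψ n x ∂μUH = ∫ x, wt n M x * ζ x * ψ n x ∂μUH := by
    intro n
    refine pair_eq _ (hN n) _ _ _ (hcell n) ?_ ?_ ?_
    · exact (hηi n).mul_bdd (c := B) (hψm n).aestronglyMeasurable (ae_of_all _ fun x => hB _)
    · exact (hwi n).mul_bdd (c := B) (hψm n).aestronglyMeasurable (ae_of_all _ fun x => hB _)
    · intro i
      refine ⟨φ (((idx i).1 + 1 : ℤ) / ((n+1:ℕ):ℝ), (((idx i).2 : ℤ) + 1 : ℤ) / ((n+1:ℕ):ℝ)), fun x hx => ?_⟩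
      have := (mem_cell' _ (hN n) i x).1 hx
      simp only [hψ, rnd, this.1, this.2]
  have hu : UniformContinuous φ := hs.uniformContinuous_of_continuous hφ
  have D : Tendsto (fun n => ∫ x, (η n x : ℝ) * φ x ∂μUH - ∫ x, (η n x : ℝ) * ψ n x ∂μUH) atTop (𝓝 0) := by
    rw [Metric.tendsto_atTop]
    intro ε hε
    set m := ∫ x, ζ x ∂μUH
    have hm0 : 0 ≤ m := integral_nonneg hnn
    obtain ⟨δ, hδ, hd⟩ := Metric.uniformContinuous_iff.1 hu (ε / (m + 1)) (by positivity)
    obtain ⟨n0, hn0⟩ := exists_nat_one_div_lt hδ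
    refine ⟨n0, fun n hn => ?_⟩
    have hdn : ∀ x, ‖φ x - ψ n x‖ ≤ ε / (m + 1) := by
      intro x
      have h1 : dist x (rnd ((n+1:ℕ):ℝ) x) < δ := by
        rw [dist_comm]
        refine (rnd_dist _ (hN n) x).trans_lt (lt_of_le_of_lt ?_ hn0)
        push_cast
        gcongr
      exact (hd h1).le
    rw [← integral_sub ((hηi n).mul_bdd (c := B) hφ.aestronglyMeasurable (ae_of_all _ fun x => hB _))
      ((hηi n).mul_bdd (c := B) (hψm n).aestronglyMeasurable (ae_of_all _ fun x => hB _)), dist_zero_right]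
    calc _ ≤ ∫ x, (η n x : ℝ) * (ε / (m + 1)) ∂μUH := by
          refine norm_integral_le_of_norm_le ((hηi n).mul_const _) (ae_of_all _ fun x => ?_)
          rw [← mul_sub, norm_mul, Real.norm_of_nonneg (NNReal.coe_nonneg (η n x))]
          exact mul_le_mul_of_nonneg_left (hdn x) (NNReal.coe_nonneg (η n x))
      _ ≤ m * (ε / (m + 1)) := by
          rw [integral_mul_const]
          exact mul_le_mul_of_nonneg_right (hmass n) (by positivity)
      _ < ε := by
          rw [mul_div_assoc', div_lt_iff₀ (by positivity)]
          nlinarith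
  have := D.add A
  simp_rw [E] at this
  simpa using this

lemma holder_bd (p q : ℝ) (h : p.HolderConjugate q) (f g : ℝ × ℝ → ℝ)
    (hf : MemLp f (ENNReal.ofReal p) μUH) (hg : MemLp g (ENNReal.ofReal q) μUH) :
    Integrable (fun x => f x * g x) μUH ∧
    ‖∫ x, f x * g x ∂μUH‖ₑ ≤ eLpNorm f (ENNReal.ofReal p) μUH * eLpNorm g (ENNReal.ofReal q) μUH := by
  have : ENNReal.HolderConjugate (ENNReal.ofReal p) (ENNReal.ofReal q) := h.ennrealOfReal
  refine ⟨hf.integrable_mul hg, ?_⟩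
  refine (enorm_integral_le_lintegral_enorm _).trans ?_
  rw [← eLpNorm_one_eq_lintegral_enorm]
  exact eLpNorm_smul_le_mul_eLpNorm (f := g) (φ := f) hg.1 hf.1

/-- Lemma 7: every element of `𝒲(ζ₀, ≤ i₀)` is a weak `L^p` limit of elements
of `ℛ⁺(ζ₀)` with impulse at most `i₀`. -/
theorem stmt_6 (p q : ℝ) (hp : 1 < p) (hpq : 1 / p + 1 / q = 1)
    (i₀ : ℝ) (hi₀ : 0 < i₀) (ζ₀ : ℝ × ℝ → ℝ)
    (h0nn : ∀ x, 0 ≤ ζ₀ x) (h0mem : MemLp ζ₀ (ENNReal.ofReal p) μUH)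
    (h0supp : HasCompactSupport ζ₀)
    (ζ : ℝ × ℝ → ℝ) (hζ : ζ ∈ Wle ζ₀ i₀) :
    ∃ ζn : ℕ → ℝ × ℝ → ℝ,
      (∀ n, memRplus ζ₀ (ζn n) ∧ impulse (ζn n) ≤ i₀) ∧
      (∀ g : ℝ × ℝ → ℝ, MemLp g (ENNReal.ofReal q) μUH →
        Tendsto (fun n => ∫ x, ζn n x * g x ∂μUH) atTop (nhds (∫ x, ζ x * g x ∂μUH))) := by
  obtain ⟨⟨hnn, hint, hprec⟩, himp⟩ := hζ
  have hH : p.HolderConjugate q := by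
    rw [Real.holderConjugate_iff]
    exact ⟨hp, by simpa [one_div] using hpq⟩
  have hp1 : (1 : ℝ≥0∞) ≤ ENNReal.ofReal p := by
    rw [← ENNReal.ofReal_one]; exact ENNReal.ofReal_le_ofReal hp.le
  have : IsLocallyFiniteMeasure μUH := by unfold μUH; infer_instance
  -- the support has finite measure
  have hsup : μUH (tsupport ζ₀) < ⊤ := h0supp.isCompact.measure_lt_top
  have hpos : ∀ a : ℝ, 0 ≤ a → μUH {x | a < ζ₀ x} ≤ μUH (tsupport ζ₀) := by
    intro a ha
    refine measure_mono fun x hx => subset_tsupport _ ?_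
    exact (lt_of_le_of_lt ha hx).ne'
  have hfin : ∀ a : ℝ≥0, μUH {x | (a : ℝ) < ζ₀ x} ≠ ⊤ := fun a => ((hpos a a.2).trans_lt hsup).ne
  have h0i : Integrable ζ₀ μUH := by
    have hf : IsFiniteMeasure (μUH.restrict (tsupport ζ₀)) := ⟨by simpa using hsup⟩
    have h1 : IntegrableOn ζ₀ (tsupport ζ₀) μUH := (h0mem.restrict (tsupport ζ₀)).integrable hp1
    exact (integrableOn_iff_integrable_of_support_subset (subset_tsupport ζ₀)).1 h1
  have h0m : AEMeasurable ζ₀ μUH := h0i.1.aemeasurable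
  have hν : ∀ a : ℝ≥0, ((μUH.map ζ₀).restrict (Set.Ioi 0)) (Set.Ioi (a:ℝ)) = μUH {x | (a:ℝ) < ζ₀ x} := by
    intro a
    rw [Measure.restrict_eq_self _ (Set.Ioi_subset_Ioi (NNReal.coe_nonneg a)), Measure.map_apply_of_aemeasurable h0m measurableSet_Ioi]
    rfl
  have hνf : IsFiniteMeasure ((μUH.map ζ₀).restrict (Set.Ioi 0)) := by
    refine ⟨?_⟩
    rw [Measure.restrict_apply_univ, Measure.map_apply_of_aemeasurable h0m measurableSet_Ioi]
    exact (hpos 0 le_rfl).trans_lt hsup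
  obtain ⟨h, hm, hD⟩ := exists_quantile ((μUH.map ζ₀).restrict (Set.Ioi 0))
  simp_rw [hν] at hD
  obtain ⟨M, hM⟩ := exists_nat_ge (μUH {x | 0 < ζ₀ x}).toReal
  have hfin0 : μUH {x | 0 < ζ₀ x} ≠ ⊤ := by simpa using hfin 0
  have h0M : μUH {x | 0 < ζ₀ x} ≤ ENNReal.ofReal M := by
    rw [← ENNReal.ofReal_toReal hfin0]
    exact ENNReal.ofReal_le_ofReal hM
  have hneg : ∀ t, t ≤ 0 → h t = 0 := by
    intro t ht
    by_contra hc
    exact absurd ((hD 0 t).1 (pos_iff_ne_zero.2 hc)).1 (not_lt.2 ht)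
  have hI : CutInv μUH (fun x => ENNReal.ofReal (ζ x)) M Set.univ h := by
    refine ⟨hm, ?_, hneg, ?_, ?_⟩
    · have hdist : ∀ a : ℝ, 0 < a → μUH {x | a < ζ₀ x} = volume {t | a < (h t : ℝ)} := by
        intro a ha
        lift a to ℝ≥0 using ha.le
        have : {t | (a : ℝ) < (h t : ℝ)} = {t : ℝ | 0 < t ∧ ENNReal.ofReal t < μUH {x | (a : ℝ) < ζ₀ x}} := by
          ext t
          simp only [Set.mem_ofPred_eq, ← hD]
          exact NNReal.coe_lt_coe
        rw [this, volume_lt_set _ (hfin a)]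
      have := lintegral_trunc_eq μUH volume ζ₀ (fun t => (h t : ℝ)) h0m (by fun_prop) hdist 0 le_rfl
      simp only [sub_zero, ENNReal.ofReal_coe_nnreal] at this
      rw [← this, ← ofReal_integral_eq_lintegral_ofReal h0i (ae_of_all _ h0nn)]
      exact ENNReal.ofReal_ne_top
    · intro t ht
      by_contra hc
      have := ((hD 0 t).1 (pos_iff_ne_zero.2 hc)).2
      simp only [NNReal.coe_zero] at this
      exact absurd (this.trans_le h0M) (not_lt.2 (ENNReal.ofReal_le_ofReal ht.le))
    · intro E _ _ hE
      exact (hardy ζ₀ ζ h0i hnn hint hprec h hm hD hfin E hE).trans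
        (lintegral_mono_set fun t ht => ht.2)
  choose η hηm hηR hηI hηc hηd using stage ζ₀ h M M hD h0M i₀ hi₀ ζ hnn hint himp hI
  refine ⟨fun n x => (η n x : ℝ), fun n => ⟨hηR n, hηI n⟩, fun g hg => ?_⟩
  have hζp : MemLp ζ (ENNReal.ofReal p) μUH := lp_of_prec p hp ζ₀ ζ h0i h0nn h0mem hnn hint hprec
  have hηle : ∀ n, eLpNorm (fun x => (η n x : ℝ)) (ENNReal.ofReal p) μUH ≤ eLpNorm ζ₀ (ENNReal.ofReal p) μUH := by
    intro n
    exact lp_of_dist p hp ζ₀ _ h0nn h0m (fun x => NNReal.coe_nonneg _) (hηm n).coe_nnreal_real.aemeasurable (hηd n)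
  have hηp : ∀ n, MemLp (fun x => (η n x : ℝ)) (ENNReal.ofReal p) μUH := fun n =>
    ⟨(hηm n).coe_nnreal_real.aestronglyMeasurable, (hηle n).trans_lt h0mem.2⟩
  set K : ℝ := (eLpNorm ζ₀ (ENNReal.ofReal p) μUH).toReal + (eLpNorm ζ (ENNReal.ofReal p) μUH).toReal with hK
  have hK0 : 0 ≤ K := by positivity
  have bd : ∀ f : ℝ × ℝ → ℝ, MemLp f (ENNReal.ofReal p) μUH → (eLpNorm f (ENNReal.ofReal p) μUH).toReal ≤ K →
      ∀ k : ℝ × ℝ → ℝ, MemLp k (ENNReal.ofReal q) μUH → ∀ ε : ℝ, 0 ≤ ε →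
      eLpNorm k (ENNReal.ofReal q) μUH ≤ ENNReal.ofReal ε → |∫ x, f x * k x ∂μUH| ≤ K * ε := by
    intro f hf hfK k hk ε hε hkε
    have h1 := (holder_bd p q hH f k hf hk).2
    rw [← Real.norm_eq_abs, ← ENNReal.ofReal_le_ofReal_iff (by positivity), ofReal_norm, ENNReal.ofReal_mul hK0]
    refine h1.trans (mul_le_mul' ?_ hkε)
    rw [← ENNReal.ofReal_toReal hf.2.ne]
    exact ENNReal.ofReal_le_ofReal hfK
  rw [Metric.tendsto_atTop]
  intro ε hε
  have hδ : 0 < ε / (3 * (K + 1)) := by positivity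
  obtain ⟨φ, hφs, hφd, hφc, hφm⟩ := hg.exists_hasCompactSupport_eLpNorm_sub_le ENNReal.ofReal_ne_top
    (ε := ENNReal.ofReal (ε / (3 * (K + 1)))) (by simpa using hδ)
  have hconv := (conv_test M ζ hnn hint η hηm hηc φ hφc hφs).2
  obtain ⟨n0, hn0⟩ := (Metric.tendsto_atTop.1 hconv) (ε / 3) (by positivity)
  refine ⟨n0, fun n hn => ?_⟩
  have h3 := hn0 n hn
  have split : ∀ f : ℝ × ℝ → ℝ, MemLp f (ENNReal.ofReal p) μUH →
      ∫ x, f x * g x ∂μUH = ∫ x, f x * φ x ∂μUH + ∫ x, f x * (g - φ) x ∂μUH := by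
    intro f hf
    rw [← integral_add (holder_bd p q hH f φ hf hφm).1 (holder_bd p q hH f _ hf (hg.sub hφm)).1]
    congr 1; ext x; simp only [Pi.sub_apply]; ring
  have b1 := bd _ (hηp n) ((ENNReal.toReal_mono h0mem.2.ne (hηle n)).trans
    (by rw [hK]; linarith [ENNReal.toReal_nonneg (a := eLpNorm ζ (ENNReal.ofReal p) μUH)])) _ (hg.sub hφm) _ hδ.le hφd
  have b2 := bd _ hζp
    (by rw [hK]; linarith [ENNReal.toReal_nonneg (a := eLpNorm ζ₀ (ENNReal.ofReal p) μUH)]) _ (hg.sub hφm) _ hδ.le hφd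
  have hlt : K * (ε / (3 * (K + 1))) < ε / 3 := by
    rw [show K * (ε / (3 * (K + 1))) = (ε / 3) * (K / (K + 1)) by field_simp]
    exact mul_lt_of_lt_one_right (by positivity) ((div_lt_one (by positivity)).2 (by linarith))
  rw [split _ (hηp n), split _ hζp]
  rw [Real.dist_eq] at h3 ⊢
  rw [abs_lt] at h3 ⊢
  rw [abs_le] at b1 b2
  constructor <;> linarith [h3.1, h3.2, b1.1, b1.2, b2.1, b2.2]
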